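/- arXiv:1402.4379 — 3 statements merged into one kernel-verified Lean document; each statement's English description precedes it below -/
import Mathlib

section
/- Let B : ℝ² → ℝ be a smooth function for which there exists s > 4 such that for every multi-index β ∈ ℕ² there is a constant C_β > 0 with |∂^β B(x)| ≤ C_β (1+|x|)^{-s-|β|} for all x ∈ ℝ². Set α = (1/(2π)) ∫_{ℝ²} B(x) dx and assume α ≠ 0. Then there exists a continuously differentiable vector field A : ℝ² → ℝ² such that ∂₁A₂(x) − ∂₂A₁(x) = B(x) for all x ∈ ℝ², and such that (1+|x|)³ (∂₁A₁(x) + ∂₂A₂(x)) → 0 and (1+|x|)³ |A(x) − A₀(x)| → 0 as |x| → ∞. -/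
open scoped Real
open Filter Classical

noncomputable section

abbrev E2 := EuclideanSpace ℝ (Fin 2)

/-- Partial derivative in the `i`-th coordinate direction. -/
noncomputable def pd (i : Fin 2) (f : E2 → ℝ) : E2 → ℝ :=
  fun x => fderiv ℝ f x (EuclideanSpace.single i 1)

/-- Iterated partial derivative of multi-order `β`. -/
noncomputable def pdMulti (β : ℕ × ℕ) (f : E2 → ℝ) : E2 → ℝ :=
  (pd 0)^[β.1] ((pd 1)^[β.2] f)

/-- The vector in `ℝ²` with given coordinates. -/
noncomputable def mk2 (a b : ℝ) : E2 := (WithLp.equiv 2 (Fin 2 → ℝ)).symm ![a, b]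

/-- The reference vector potential `A₀`. -/

noncomputable def A0 (α : ℝ) (x : E2) : E2 :=
  if x = 0 then 0
  else if ‖x‖ ≤ 1 then (α / ‖x‖) • mk2 (-(x 1)) (x 0)
  else (α / ‖x‖ ^ 2) • mk2 (-(x 1)) (x 0)

open MeasureTheory Set Topology

/-- `B` is `C¹` and decays like `‖x‖ ^ (-s)` with its derivative one order better, `4 < s`. -/
structure DecaysC1 (B : E2 → ℝ) (s C : ℝ) : Prop where
  contDiff : ContDiff ℝ 1 B
  four_lt : 4 < s
  nonneg : 0 ≤ C
  norm_le : ∀ x, ‖B x‖ ≤ C * (1 + ‖x‖) ^ (-s)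
  norm_fderiv_le : ∀ x, ‖fderiv ℝ B x‖ ≤ C * (1 + ‖x‖) ^ (-s - 1)

/-- The first radial moment of `B` along the ray through `x`, over parameters in `S`. -/
def radialMoment (B : E2 → ℝ) (S : Set ℝ) (x : E2) : ℝ := ∫ t in S, t * B (t • x)

/-- The derivative of `radialMoment B S`, obtained by differentiating under the integral sign. -/
def radialMomentDeriv (B : E2 → ℝ) (S : Set ℝ) (x : E2) : E2 →L[ℝ] ℝ :=
  ∫ t in S, (t ^ 2) • fderiv ℝ B (t • x)

theorem ContDiff.continuous_smul_fderiv {B : E2 → ℝ} (hB : ContDiff ℝ 1 B) :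
    Continuous fun p : ℝ × E2 => (p.1 ^ 2) • fderiv ℝ B (p.1 • p.2) := by
  have := hB.continuous_fderiv (by simp)
  fun_prop

theorem radialMoment_hasFDerivAt_of_bound {B : E2 → ℝ} (hB : ContDiff ℝ 1 B) {S : Set ℝ}
    (hS : MeasurableSet S) {x₀ : E2} {U : Set E2} (hU : U ∈ 𝓝 x₀) {bound : ℝ → ℝ}
    (hint : IntegrableOn bound S)
    (hbound : ∀ t ∈ S, ∀ x ∈ U, ‖(t ^ 2) • fderiv ℝ B (t • x)‖ ≤ bound t)
    (h0 : IntegrableOn (fun t => t * B (t • x₀)) S) :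
    HasFDerivAt (radialMoment B S) (radialMomentDeriv B S x₀) x₀ ∧
      ContinuousAt (radialMomentDeriv B S) x₀ := by
  have hc := hB.continuous
  have hd := hB.continuous_smul_fderiv
  have hmeas : ∀ x : E2, AEStronglyMeasurable (fun t : ℝ => (t ^ 2) • fderiv ℝ B (t • x))
      (volume.restrict S) := fun x =>
    (hd.comp (by fun_prop : Continuous fun t : ℝ => (t, x))).aestronglyMeasurable
  constructor
  · refine hasFDerivAt_integral_of_dominated_of_fderiv_le (s := U) (bound := bound)
      (F := fun x t => t * B (t • x)) (F' := fun x t => (t ^ 2) • fderiv ℝ B (t • x)) hU ?_ h0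
      (hmeas x₀) ?_ hint ?_
    · exact Eventually.of_forall fun x => Continuous.aestronglyMeasurable (by fun_prop)
    · exact (ae_restrict_iff' hS).2 (Eventually.of_forall fun t ht x hx => hbound t ht x hx)
    · refine Eventually.of_forall fun t x _ => ?_
      have h1 : HasFDerivAt (fun x : E2 => t • x) (t • ContinuousLinearMap.id ℝ E2) x :=
        (hasFDerivAt_id x).const_smul t
      have h2 := ((hB.differentiable (by simp) (t • x)).hasFDerivAt.comp x h1).const_mul t
      refine h2.congr_fderiv ?_
      ext v
      simp
      ring
  · refine continuousAt_of_dominated (bound := bound)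
      (F := fun x t => (t ^ 2) • fderiv ℝ B (t • x)) (Eventually.of_forall hmeas) ?_ hint ?_
    · filter_upwards [hU] with x hx
      exact (ae_restrict_iff' hS).2 (Eventually.of_forall fun t ht => hbound t ht x hx)
    · exact Eventually.of_forall fun t =>
        (hd.comp (by fun_prop : Continuous fun x : E2 => (t, x))).continuousAt

namespace DecaysC1

variable {B : E2 → ℝ} {s C : ℝ}

theorem norm_fderiv_le_const (h : DecaysC1 B s C) (x : E2) : ‖fderiv ℝ B x‖ ≤ C := by
  refine (h.norm_fderiv_le x).trans (mul_le_of_le_one_right h.nonneg ?_)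
  exact Real.rpow_le_one_of_one_le_of_nonpos (by linarith [norm_nonneg x]) (by linarith [h.four_lt])

theorem rpow_ray_le {k a t : ℝ} (hk : 0 < k) (hk1 : k ≤ 1) (ht : 0 ≤ t) (ha : a ≤ 0) {x : E2}
    (hx : k ≤ ‖x‖) : (1 + ‖t • x‖) ^ a ≤ k ^ a * (1 + ‖t‖) ^ a := by
  rw [← Real.mul_rpow hk.le (by positivity)]
  refine Real.rpow_le_rpow_of_nonpos (by positivity) ?_ ha
  rw [norm_smul, Real.norm_of_nonneg ht]
  nlinarith [mul_le_mul_of_nonneg_left hx ht]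

theorem norm_ray_fderiv_le (h : DecaysC1 B s C) {k t : ℝ} (hk : 0 < k) (hk1 : k ≤ 1) (ht : 0 ≤ t)
    {x : E2} (hx : k ≤ ‖x‖) :
    ‖(t ^ 2) • fderiv ℝ B (t • x)‖ ≤ C * k ^ (-s - 1) * (1 + ‖t‖) ^ (-(s - 1)) := by
  have hs := h.four_lt
  have h1 := (h.norm_fderiv_le (t • x)).trans (mul_le_mul_of_nonneg_left
    (rpow_ray_le hk hk1 ht (by linarith : -s - 1 ≤ 0) hx) h.nonneg)
  have h2 : t ^ 2 ≤ (1 + ‖t‖) ^ (2 : ℝ) := by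
    rw [Real.norm_of_nonneg ht]
    norm_cast
    gcongr
    linarith
  rw [norm_smul, norm_pow]
  nth_rw 1 [Real.norm_of_nonneg ht]
  calc t ^ 2 * ‖fderiv ℝ B (t • x)‖
      ≤ (1 + ‖t‖) ^ (2 : ℝ) * (C * (k ^ (-s - 1) * (1 + ‖t‖) ^ (-s - 1))) := by gcongr
    _ = C * k ^ (-s - 1) * ((1 + ‖t‖) ^ (2 : ℝ) * (1 + ‖t‖) ^ (-s - 1)) := by ring
    _ = _ := by
      rw [← Real.rpow_add (by positivity)]
      congr 2
      ring

theorem norm_ray_le (h : DecaysC1 B s C) {k t : ℝ} (hk : 0 < k) (hk1 : k ≤ 1) (ht : 0 ≤ t)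
    {x : E2} (hx : k ≤ ‖x‖) :
    ‖t * B (t • x)‖ ≤ C * k ^ (-s) * (1 + ‖t‖) ^ (-(s - 1)) := by
  have hs := h.four_lt
  have h1 := (h.norm_le (t • x)).trans (mul_le_mul_of_nonneg_left
    (rpow_ray_le hk hk1 ht (by linarith : -s ≤ 0) hx) h.nonneg)
  have h2 : t ≤ (1 + ‖t‖) ^ (1 : ℝ) := by
    rw [Real.norm_of_nonneg ht, Real.rpow_one]
    linarith
  rw [norm_mul]
  nth_rw 1 [Real.norm_of_nonneg ht]
  calc t * ‖B (t • x)‖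
      ≤ (1 + ‖t‖) ^ (1 : ℝ) * (C * (k ^ (-s) * (1 + ‖t‖) ^ (-s))) := by gcongr
    _ = C * k ^ (-s) * ((1 + ‖t‖) ^ (1 : ℝ) * (1 + ‖t‖) ^ (-s)) := by ring
    _ = _ := by
      rw [← Real.rpow_add (by positivity)]
      congr 2
      ring

theorem integrable_majorant (h : DecaysC1 B s C) (c : ℝ) :
    Integrable fun t : ℝ => c * (1 + ‖t‖) ^ (-(s - 1)) :=
  (integrable_one_add_norm (by simpa using by linarith [h.four_lt])).const_mul _

theorem integrableOn_ray (h : DecaysC1 B s C) {S : Set ℝ} (hS : MeasurableSet S)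
    (hS0 : S ⊆ Ioi 0) {x : E2} (hx : x ≠ 0) : IntegrableOn (fun t => t * B (t • x)) S := by
  have hc := h.contDiff.continuous
  have hk : 0 < min 1 ‖x‖ := by simpa using hx
  refine Integrable.mono' (h.integrable_majorant (C * (min 1 ‖x‖) ^ (-s))).integrableOn
    (Continuous.aestronglyMeasurable (by fun_prop)) ?_
  exact (ae_restrict_iff' hS).2 (Eventually.of_forall fun t ht =>
    h.norm_ray_le hk (min_le_left _ _) (hS0 ht).le (min_le_right _ _))

theorem radialMoment_hasFDerivAt (h : DecaysC1 B s C) {S : Set ℝ} (hS : MeasurableSet S)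
    (hS0 : S ⊆ Ioi 0) {x : E2} (hx : x ≠ 0) :
    HasFDerivAt (radialMoment B S) (radialMomentDeriv B S x) x ∧
      ContinuousAt (radialMomentDeriv B S) x := by
  have hk : 0 < min 1 (‖x‖ / 2) := by simpa using hx
  refine radialMoment_hasFDerivAt_of_bound h.contDiff hS (U := {y | ‖x‖ / 2 < ‖y‖}) ?_
    (h.integrable_majorant (C * (min 1 (‖x‖ / 2)) ^ (-s - 1))).integrableOn ?_
    (h.integrableOn_ray hS hS0 hx)
  · exact (isOpen_lt continuous_const continuous_norm).mem_nhds
      (half_lt_self (norm_pos_iff.2 hx))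
  · intro t ht y hy
    exact h.norm_ray_fderiv_le hk (min_le_left _ _) (hS0 ht).le ((min_le_right _ _).trans hy.le)

theorem radialMoment_unit_hasFDerivAt (h : DecaysC1 B s C) (x : E2) :
    HasFDerivAt (radialMoment B (Ioc 0 1)) (radialMomentDeriv B (Ioc 0 1) x) x ∧
      ContinuousAt (radialMomentDeriv B (Ioc 0 1)) x := by
  have hc := h.contDiff.continuous
  refine radialMoment_hasFDerivAt_of_bound h.contDiff measurableSet_Ioc univ_mem
    (bound := fun _ => C) (integrableOn_const (by simp)) ?_ ?_
  · intro t ht y _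
    rw [norm_smul, norm_pow, Real.norm_of_nonneg ht.1.le]
    have h2 : t ^ 2 ≤ 1 := pow_le_one₀ ht.1.le ht.2
    calc t ^ 2 * ‖fderiv ℝ B (t • y)‖ ≤ 1 * C := by
          gcongr
          exact h.norm_fderiv_le_const _
      _ = C := one_mul C
  · exact (Continuous.integrableOn_Icc (by fun_prop)).mono_set Ioc_subset_Icc_self

theorem contDiff_radialMoment_unit (h : DecaysC1 B s C) :
    ContDiff ℝ 1 (radialMoment B (Ioc 0 1)) :=
  contDiff_one_iff_hasFDerivAt.2 ⟨radialMomentDeriv B (Ioc 0 1),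
    continuous_iff_continuousAt.2 fun x => (h.radialMoment_unit_hasFDerivAt x).2,
    fun x => (h.radialMoment_unit_hasFDerivAt x).1⟩

theorem contDiffAt_radialMoment (h : DecaysC1 B s C) {S : Set ℝ} (hS : MeasurableSet S)
    (hS0 : S ⊆ Ioi 0) {x : E2} (hx : x ≠ 0) : ContDiffAt ℝ 1 (radialMoment B S) x := by
  have hU : {y : E2 | y ≠ 0} ∈ 𝓝 x := isOpen_ne.mem_nhds hx
  refine (contDiffAt_succ_iff_hasFDerivAt (n := 0)).2 ⟨radialMomentDeriv B S,
    ⟨_, hU, fun y hy => (h.radialMoment_hasFDerivAt hS hS0 hy).1⟩, contDiffAt_zero.2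
    ⟨_, hU, fun y hy => (h.radialMoment_hasFDerivAt hS hS0 hy).2.continuousWithinAt⟩⟩

/-- The identity `div (x P(x)) = B(x)` for the radial moment `P` over `(0, 1]`. -/
theorem two_mul_radialMoment_unit (h : DecaysC1 B s C) (x : E2) :
    2 * radialMoment B (Ioc 0 1) x + fderiv ℝ (radialMoment B (Ioc 0 1)) x x = B x := by
  have hc := h.contDiff.continuous
  have hd : Continuous fun t : ℝ => (t ^ 2) • fderiv ℝ B (t • x) :=
    h.contDiff.continuous_smul_fderiv.comp (by fun_prop : Continuous fun t : ℝ => (t, x))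
  have hd' : Continuous fun t : ℝ => ((t ^ 2) • fderiv ℝ B (t • x)) x := by fun_prop
  rw [(h.radialMoment_unit_hasFDerivAt x).1.fderiv, radialMomentDeriv, radialMoment,
    ContinuousLinearMap.integral_apply
      ((hd.integrableOn_Icc (μ := volume)).mono_set Ioc_subset_Icc_self),
    ← intervalIntegral.integral_of_le zero_le_one, ← intervalIntegral.integral_of_le zero_le_one,
    ← intervalIntegral.integral_const_mul, ← intervalIntegral.integral_add
      (Continuous.intervalIntegrable (by fun_prop) _ _) (hd'.intervalIntegrable _ _)]
  have key : ∀ t ∈ uIcc (0 : ℝ) 1, HasDerivAt (fun t : ℝ => t ^ 2 * B (t • x))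
      (2 * (t * B (t • x)) + ((t ^ 2) • fderiv ℝ B (t • x)) x) t := by
    intro t _
    have h1 : HasDerivAt (fun t : ℝ => t • x) x t := by
      simpa using (hasDerivAt_id t).smul_const x
    have h2 := (h.contDiff.differentiable (by simp) (t • x)).hasFDerivAt.comp_hasDerivAt t h1
    have h3 := (hasDerivAt_pow 2 t).mul h2
    refine h3.congr_deriv ?_
    simp
    ring
  rw [intervalIntegral.integral_eq_sub_of_hasDerivAt key
    (Continuous.intervalIntegrable (by fun_prop) _ _)]
  simp

theorem rpow_far_le {a t : ℝ} (ht : 0 < t) (ha : a ≤ 0) {x : E2} (hx : x ≠ 0) :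
    (1 + ‖t • x‖) ^ a ≤ ‖x‖ ^ a * t ^ a := by
  have hx' := norm_pos_iff.2 hx
  rw [← Real.mul_rpow hx'.le ht.le]
  refine Real.rpow_le_rpow_of_nonpos (by positivity) ?_ ha
  rw [norm_smul, Real.norm_of_nonneg ht.le]
  linarith [mul_comm t ‖x‖]

theorem integrableOn_far (h : DecaysC1 B s C) (c : ℝ) :
    IntegrableOn (fun t : ℝ => c * t ^ (1 - s)) (Ioi 1) :=
  (integrableOn_Ioi_rpow_of_lt (by linarith [h.four_lt]) one_pos).const_mul c

theorem norm_radialMoment_far_le (h : DecaysC1 B s C) {x : E2} (hx : x ≠ 0) :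
    ‖radialMoment B (Ioi 1) x‖ ≤ C * (∫ t in Ioi (1 : ℝ), t ^ (1 - s)) * ‖x‖ ^ (-s) := by
  have hs := h.four_lt
  refine (norm_integral_le_of_norm_le (h.integrableOn_far (C * ‖x‖ ^ (-s))) ?_).trans_eq ?_
  · refine (ae_restrict_iff' measurableSet_Ioi).2 (Eventually.of_forall fun t ht => ?_)
    have ht0 : (0 : ℝ) < t := one_pos.trans ht
    rw [norm_mul, Real.norm_of_nonneg ht0.le]
    calc t * ‖B (t • x)‖ ≤ t * (C * (‖x‖ ^ (-s) * t ^ (-s))) := by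
          gcongr
          exact (h.norm_le _).trans (mul_le_mul_of_nonneg_left
            (rpow_far_le ht0 (by linarith) hx) h.nonneg)
      _ = C * ‖x‖ ^ (-s) * (t ^ (1 : ℝ) * t ^ (-s)) := by rw [Real.rpow_one]; ring
      _ = _ := by rw [← Real.rpow_add ht0]; rfl
  · rw [integral_const_mul]
    ring

theorem norm_fderiv_radialMoment_far_le (h : DecaysC1 B s C) {x : E2} (hx : x ≠ 0) :
    ‖fderiv ℝ (radialMoment B (Ioi 1)) x‖ ≤
      C * (∫ t in Ioi (1 : ℝ), t ^ (1 - s)) * ‖x‖ ^ (-s - 1) := by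
  have hs := h.four_lt
  rw [(h.radialMoment_hasFDerivAt measurableSet_Ioi (Ioi_subset_Ioi zero_le_one) hx).1.fderiv]
  refine (norm_integral_le_of_norm_le (h.integrableOn_far (C * ‖x‖ ^ (-s - 1))) ?_).trans_eq ?_
  · refine (ae_restrict_iff' measurableSet_Ioi).2 (Eventually.of_forall fun t ht => ?_)
    have ht0 : (0 : ℝ) < t := one_pos.trans ht
    rw [norm_smul, norm_pow, Real.norm_of_nonneg ht0.le]
    calc t ^ 2 * ‖fderiv ℝ B (t • x)‖ ≤ t ^ 2 * (C * (‖x‖ ^ (-s - 1) * t ^ (-s - 1))) := by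
          gcongr
          exact (h.norm_fderiv_le _).trans (mul_le_mul_of_nonneg_left
            (rpow_far_le ht0 (by linarith) hx) h.nonneg)
      _ = C * ‖x‖ ^ (-s - 1) * (t ^ (2 : ℝ) * t ^ (-s - 1)) := by norm_cast; ring
      _ = _ := by
        rw [← Real.rpow_add ht0]
        congr 2
        ring
  · rw [integral_const_mul]
    ring

theorem radialMoment_Ioi_zero (h : DecaysC1 B s C) {x : E2} (hx : x ≠ 0) :
    radialMoment B (Ioi 0) x = radialMoment B (Ioc 0 1) x + radialMoment B (Ioi 1) x := by
  rw [radialMoment, ← Ioc_union_Ioi_eq_Ioi (zero_le_one : (0 : ℝ) ≤ 1),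
    setIntegral_union Ioc_disjoint_Ioi_same measurableSet_Ioi
      (h.integrableOn_ray measurableSet_Ioc Ioc_subset_Ioi_self hx)
      (h.integrableOn_ray measurableSet_Ioi (Ioi_subset_Ioi zero_le_one) hx)]
  rfl

end DecaysC1

theorem radialMoment_smul (B : E2 → ℝ) {r : ℝ} (hr : 0 < r) (x : E2) :
    radialMoment B (Ioi 0) (r • x) = (r ^ 2)⁻¹ * radialMoment B (Ioi 0) x := by
  have h1 := integral_comp_mul_left_Ioi (fun t => t * B (t • x)) 0 hr
  rw [mul_zero, smul_eq_mul] at h1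
  have h2 : radialMoment B (Ioi 0) (r • x)
      = r⁻¹ * ∫ t in Ioi (0 : ℝ), r * t * B ((r * t) • x) := by
    rw [radialMoment, ← integral_const_mul]
    refine integral_congr_ae (Eventually.of_forall fun t => ?_)
    simp only [smul_smul, mul_comm t r]
    field_simp
  rw [h2, h1, radialMoment]
  field_simp

@[simp] theorem mk2_apply_zero (a b : ℝ) : mk2 a b 0 = a := rfl

@[simp] theorem mk2_apply_one (a b : ℝ) : mk2 a b 1 = b := rfl

theorem E2.norm_sq_eq (x : E2) : ‖x‖ ^ 2 = x 0 ^ 2 + x 1 ^ 2 := by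
  simp [EuclideanSpace.norm_sq_eq]

/-- The point of the unit circle at angle `θ`. -/
def circlePoint (θ : ℝ) : E2 := mk2 (Real.cos θ) (Real.sin θ)

theorem norm_circlePoint (θ : ℝ) : ‖circlePoint θ‖ = 1 := by
  have h : ‖circlePoint θ‖ ^ 2 = 1 := by simp [E2.norm_sq_eq, circlePoint]
  exact (pow_eq_one_iff_of_nonneg (norm_nonneg _) two_ne_zero).1 h

theorem circlePoint_ne_zero (θ : ℝ) : circlePoint θ ≠ 0 :=
  norm_ne_zero_iff.1 (by simp [norm_circlePoint])

theorem continuous_mk2 {X : Type*} [TopologicalSpace X] {f g : X → ℝ} (hf : Continuous f)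
    (hg : Continuous g) : Continuous fun x => mk2 (f x) (g x) := by
  refine (PiLp.continuous_toLp 2 _).comp (continuous_pi fun i => ?_)
  fin_cases i
  exacts [hf, hg]

theorem continuous_circlePoint : Continuous circlePoint :=
  continuous_mk2 Real.continuous_cos Real.continuous_sin

theorem circlePoint_periodic : Function.Periodic circlePoint (2 * π) := fun θ => by
  simp [circlePoint]

theorem circlePoint_add_pi (θ : ℝ) : circlePoint (θ + π) = -circlePoint θ := by
  ext i
  fin_cases i
  · exact Real.cos_add_pi θ
  · exact Real.sin_add_pi θ

theorem repr_polarCoord_symm (p : ℝ × ℝ) :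
    Complex.orthonormalBasisOneI.repr (Complex.polarCoord.symm p) = p.1 • circlePoint p.2 := by
  ext i
  fin_cases i <;>
    simp [Complex.orthonormalBasisOneI_repr_apply, Complex.polarCoord_symm_apply, circlePoint] <;>
    exact Or.inl rfl

namespace DecaysC1

variable {B : E2 → ℝ} {s C : ℝ}

theorem continuous_radialMoment_circlePoint (h : DecaysC1 B s C) :
    Continuous fun θ => radialMoment B (Ioi 0) (circlePoint θ) :=
  continuous_iff_continuousAt.2 fun θ =>
    ContinuousAt.comp (g := radialMoment B (Ioi 0))
      (h.contDiffAt_radialMoment measurableSet_Ioi subset_rfl (circlePoint_ne_zero θ)).continuousAt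
      continuous_circlePoint.continuousAt

theorem integral_radialMoment_circlePoint (h : DecaysC1 B s C) :
    ∫ θ in (-π)..π, radialMoment B (Ioi 0) (circlePoint θ) = ∫ x, B x := by
  have hc := h.contDiff.continuous
  have hint : IntegrableOn (fun p : ℝ × ℝ => p.1 * B (p.1 • circlePoint p.2))
      (Ioi 0 ×ˢ Ioo (-π) π) (volume.prod volume) := by
    have hmaj : IntegrableOn (fun p : ℝ × ℝ => C * (1 + ‖p.1‖) ^ (-(s - 1)))
        (Ioi 0 ×ˢ Ioo (-π) π) (volume.prod volume) := by
      rw [IntegrableOn, ← Measure.prod_restrict]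
      exact (h.integrable_majorant C).integrableOn.comp_fst _
    refine Integrable.mono' hmaj (Continuous.aestronglyMeasurable ?_) ?_
    · have := continuous_circlePoint
      fun_prop
    · refine (ae_restrict_iff' (measurableSet_Ioi.prod measurableSet_Ioo)).2
        (Eventually.of_forall fun p hp => ?_)
      simpa using h.norm_ray_le one_pos le_rfl (le_of_lt hp.1) (norm_circlePoint p.2).ge
  calc ∫ θ in (-π)..π, radialMoment B (Ioi 0) (circlePoint θ)
      = ∫ θ in Ioo (-π) π, radialMoment B (Ioi 0) (circlePoint θ) := by
        rw [intervalIntegral.integral_of_le (by linarith [Real.pi_pos]), integral_Ioc_eq_integral_Ioo]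
    _ = ∫ p in Ioi 0 ×ˢ Ioo (-π) π, p.1 * B (p.1 • circlePoint p.2) := by
        rw [IntegrableOn, ← Measure.prod_restrict] at hint
        rw [Measure.volume_eq_prod, ← Measure.prod_restrict, integral_prod_symm _ hint]
        rfl
    _ = ∫ z : ℂ, B (Complex.orthonormalBasisOneI.repr z) := by
        rw [← Complex.integral_comp_polarCoord_symm]
        simp only [repr_polarCoord_symm]
        rfl
    _ = ∫ x, B x :=
        Complex.orthonormalBasisOneI.measurePreserving_repr.integral_comp
          Complex.orthonormalBasisOneI.repr.toHomeomorph.measurableEmbedding B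

end DecaysC1

/-- The primitive in the angle of the fluctuation of the radial moments around `α`. -/
def angularPotential (B : E2 → ℝ) (α θ : ℝ) : ℝ :=
  ∫ u in (0 : ℝ)..θ, (radialMoment B (Ioi 0) (circlePoint u) - α)

/-- The point of `ℂ` with the same coordinates. -/
def toComplex (x : E2) : ℂ := ⟨x 0, x 1⟩

/-- The degree-zero homogeneous extension of `angularPotential` to the punctured plane. -/
def planarPotential (B : E2 → ℝ) (α : ℝ) (x : E2) : ℝ :=
  angularPotential B α (toComplex x).arg

/-- The rotation by a right angle. -/
def rot (x : E2) : E2 := mk2 (-(x 1)) (x 0)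

theorem toComplex_ne_zero {x : E2} (hx : x ≠ 0) : toComplex x ≠ 0 := by
  contrapose! hx
  ext i
  fin_cases i
  · exact congrArg Complex.re hx
  · exact congrArg Complex.im hx

theorem norm_toComplex (x : E2) : ‖toComplex x‖ = ‖x‖ := by
  refine (pow_left_inj₀ (norm_nonneg _) (norm_nonneg _) two_ne_zero).1 ?_
  rw [E2.norm_sq_eq, ← Complex.normSq_eq_norm_sq, Complex.normSq_apply, toComplex]
  ring

theorem norm_smul_circlePoint_arg (x : E2) : ‖x‖ • circlePoint (toComplex x).arg = x := by
  ext i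
  fin_cases i
  · exact norm_toComplex x ▸ Complex.norm_mul_cos_arg (toComplex x)
  · exact norm_toComplex x ▸ Complex.norm_mul_sin_arg (toComplex x)

/-- `toComplex` as a continuous linear map. -/
def toComplexCLM : E2 →L[ℝ] ℂ :=
  Complex.orthonormalBasisOneI.repr.symm.toContinuousLinearEquiv.toContinuousLinearMap

theorem toComplexCLM_apply (x : E2) : toComplexCLM x = toComplex x := by
  refine (LinearIsometryEquiv.symm_apply_eq _).2 ?_
  ext i
  fin_cases i <;> simp [Complex.orthonormalBasisOneI_repr_apply, toComplex]

theorem inner_rot (x v : E2) : inner ℝ (rot x) v = x 0 * v 1 - x 1 * v 0 := by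
  simp [rot, PiLp.inner_apply, Fin.sum_univ_two]
  ring

theorem hasFDerivAt_arg_toComplex {x : E2} (hx : toComplex x ∈ Complex.slitPlane) :
    HasFDerivAt (fun y => (toComplex y).arg) ((‖x‖ ^ 2)⁻¹ • innerSL ℝ (rot x)) x := by
  have h1 := (Complex.hasStrictDerivAt_log hx).hasDerivAt.hasFDerivAt.restrictScalars ℝ
  have h2 : HasFDerivAt toComplex toComplexCLM x := by
    convert toComplexCLM.hasFDerivAt using 1
    exact funext fun y => (toComplexCLM_apply y).symm
  have h3 := Complex.imCLM.hasFDerivAt.comp x (h1.comp x h2)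
  refine (h3.congr_of_eventuallyEq
    (Eventually.of_forall fun y => (Complex.log_im (toComplex y)).symm)).congr_fderiv ?_
  ext v
  simp [toComplexCLM_apply, inner_rot, E2.norm_sq_eq]
  simp [toComplex, Complex.normSq_apply]
  field_simp
  ring

namespace DecaysC1

variable {B : E2 → ℝ} {s C : ℝ}

theorem hasDerivAt_angularPotential (h : DecaysC1 B s C) (α θ : ℝ) :
    HasDerivAt (angularPotential B α) (radialMoment B (Ioi 0) (circlePoint θ) - α) θ :=
  (Continuous.integral_hasStrictDerivAt
    (h.continuous_radialMoment_circlePoint.sub continuous_const) 0 θ).hasDerivAt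

theorem angularPotential_periodic (h : DecaysC1 B s C) {α : ℝ}
    (hα : α = (1 / (2 * π)) * ∫ x, B x) :
    Function.Periodic (angularPotential B α) (2 * π) := fun θ => by
  have hc : Continuous fun u => radialMoment B (Ioi 0) (circlePoint u) - α :=
    h.continuous_radialMoment_circlePoint.sub continuous_const
  have hper : Function.Periodic (fun u => radialMoment B (Ioi 0) (circlePoint u) - α) (2 * π) :=
    fun u => by simp only [circlePoint_periodic u]
  rw [← sub_eq_zero, angularPotential, angularPotential, intervalIntegral.integral_interval_sub_left
    (hc.intervalIntegrable _ _) (hc.intervalIntegrable _ _), hper.intervalIntegral_add_eq θ (-π),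
    show -π + 2 * π = π by ring, intervalIntegral.integral_sub
      (h.continuous_radialMoment_circlePoint.intervalIntegrable _ _)
      (continuous_const.intervalIntegrable _ _), h.integral_radialMoment_circlePoint, hα]
  have := Real.pi_pos
  simp
  field_simp
  ring

theorem planarPotential_eq_neg (h : DecaysC1 B s C) {α : ℝ}
    (hα : α = (1 / (2 * π)) * ∫ x, B x) {x : E2} (hx : x ≠ 0) :
    planarPotential B α x = angularPotential B α ((toComplex (-x)).arg + π) := by
  have hneg : toComplex (-x) = -toComplex x := by
    apply Complex.ext <;> simp [toComplex]
  have h1 : (((toComplex (-x)).arg + π : ℝ) : Real.Angle) = ((toComplex x).arg : ℝ) := by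
    rw [Real.Angle.coe_add, hneg, Complex.arg_neg_coe_angle (toComplex_ne_zero hx), add_assoc,
      Real.Angle.coe_pi_add_coe_pi, add_zero]
  obtain ⟨k, hk⟩ := Real.Angle.angle_eq_iff_two_pi_dvd_sub.1 h1
  rw [planarPotential, eq_add_of_sub_eq hk, add_comm, mul_comm]
  exact ((h.angularPotential_periodic hα).int_mul k _).symm

theorem hasFDerivAt_planarPotential (h : DecaysC1 B s C) {α : ℝ}
    (hα : α = (1 / (2 * π)) * ∫ x, B x) {x : E2} (hx : x ≠ 0) :
    HasFDerivAt (planarPotential B α)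
      ((radialMoment B (Ioi 0) x - α / ‖x‖ ^ 2) • innerSL ℝ (rot x)) x := by
  have hx' := norm_pos_iff.2 hx
  have hM : ∀ {θ : ℝ}, ‖x‖ • circlePoint θ = x →
      (radialMoment B (Ioi 0) (circlePoint θ) - α) * (‖x‖ ^ 2)⁻¹
        = radialMoment B (Ioi 0) x - α / ‖x‖ ^ 2 := fun {θ} hθ => by
    have := radialMoment_smul B hx' (circlePoint θ)
    rw [hθ] at this
    rw [this]
    ring
  rcases Complex.mem_slitPlane_or_neg_mem_slitPlane (toComplex_ne_zero hx) with hs | hs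
  · refine ((h.hasDerivAt_angularPotential α _).comp_hasFDerivAt x
      (hasFDerivAt_arg_toComplex hs)).congr_fderiv ?_
    rw [smul_smul, hM (norm_smul_circlePoint_arg x)]
  · have hneg : toComplex (-x) = -toComplex x := by
      apply Complex.ext <;> simp [toComplex]
    rw [← hneg] at hs
    have h1 : HasFDerivAt (fun y => (toComplex (-y)).arg + π)
        ((‖x‖ ^ 2)⁻¹ • innerSL ℝ (rot x)) x := by
      refine (((hasFDerivAt_arg_toComplex hs).comp x (hasFDerivAt_id x).neg).add_const π)
        |>.congr_fderiv ?_
      ext v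
      simp [inner_rot]
      ring
    have h2 := ((h.hasDerivAt_angularPotential α _).comp_hasFDerivAt x h1).congr_of_eventuallyEq
      (f₁ := planarPotential B α) (by
        filter_upwards [isOpen_ne.mem_nhds hx] with y hy
        exact h.planarPotential_eq_neg hα hy)
    refine h2.congr_fderiv ?_
    rw [smul_smul, hM]
    rw [circlePoint_add_pi, ← norm_neg x, smul_neg, norm_smul_circlePoint_arg, neg_neg]

theorem contDiffAt_planarPotential (h : DecaysC1 B s C) {α : ℝ}
    (hα : α = (1 / (2 * π)) * ∫ x, B x) {x : E2} (hx : x ≠ 0) :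
    ContDiffAt ℝ 2 (planarPotential B α) x := by
  refine (contDiffAt_succ_iff_hasFDerivAt (n := 1)).2 ⟨_,
    ⟨_, isOpen_ne.mem_nhds hx, fun y hy => h.hasFDerivAt_planarPotential hα hy⟩, ?_⟩
  have h1 := h.contDiffAt_radialMoment measurableSet_Ioi subset_rfl hx
  have h2 : ContDiffAt ℝ 1 (fun y : E2 => ‖y‖ ^ 2) x := (contDiff_norm_sq ℝ).contDiffAt
  have h3 : ContDiff ℝ 1 rot := by
    refine contDiff_euclidean.2 fun i => ?_
    fin_cases i <;> simp [rot] <;> fun_prop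
  exact (h1.sub (contDiffAt_const.div h2 (by simpa using hx))).smul
    ((innerSL ℝ : E2 →L[ℝ] E2 →L[ℝ] ℝ).contDiff.comp h3).contDiffAt

end DecaysC1

theorem fderiv_apply_eq_pd (f : E2 → ℝ) (x v : E2) :
    fderiv ℝ f x v = v 0 * pd 0 f x + v 1 * pd 1 f x := by
  have hv : v = v 0 • EuclideanSpace.single 0 1 + v 1 • EuclideanSpace.single 1 1 := by
    ext i
    fin_cases i <;> simp
  conv_lhs => rw [hv]
  simp [pd]

theorem norm_fderiv_le_pd (f : E2 → ℝ) (x : E2) :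
    ‖fderiv ℝ f x‖ ≤ |pd 0 f x| + |pd 1 f x| := by
  refine ContinuousLinearMap.opNorm_le_bound _ (by positivity) fun v => ?_
  rw [fderiv_apply_eq_pd]
  have h0 : |v 0| ≤ ‖v‖ := PiLp.norm_apply_le v 0
  have h1 : |v 1| ≤ ‖v‖ := PiLp.norm_apply_le v 1
  calc ‖v 0 * pd 0 f x + v 1 * pd 1 f x‖ ≤ |v 0| * |pd 0 f x| + |v 1| * |pd 1 f x| := by
        refine (norm_add_le _ _).trans_eq ?_
        simp
    _ ≤ ‖v‖ * |pd 0 f x| + ‖v‖ * |pd 1 f x| := by gcongr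
    _ = _ := by ring

theorem exists_decaysC1 {B : E2 → ℝ} (hB : ContDiff ℝ (⊤ : ℕ∞) B) {s : ℝ} (hs : 4 < s)
    (hdecay : ∀ β : ℕ × ℕ, ∃ C : ℝ, 0 < C ∧ ∀ x : E2,
      |pdMulti β B x| ≤ C * (1 + ‖x‖) ^ (-s - ((β.1 : ℝ) + (β.2 : ℝ)))) :
    ∃ C, DecaysC1 B s C := by
  obtain ⟨C₀, hC₀, h₀⟩ := hdecay (0, 0)
  obtain ⟨C₁, hC₁, h₁⟩ := hdecay (1, 0)
  obtain ⟨C₂, hC₂, h₂⟩ := hdecay (0, 1)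
  simp only [pdMulti, Function.iterate_zero, Function.iterate_one, id, Nat.cast_zero, Nat.cast_one,
    add_zero, zero_add, sub_zero] at h₀ h₁ h₂
  refine ⟨C₀ + C₁ + C₂, hB.of_le (by exact_mod_cast le_top), hs, by positivity, fun x => ?_,
    fun x => ?_⟩
  · refine (h₀ x).trans ?_
    gcongr
    linarith
  · refine (norm_fderiv_le_pd B x).trans ((add_le_add (h₁ x) (h₂ x)).trans ?_)
    rw [← add_mul]
    gcongr
    linarith

theorem pd_coord_mul (i j : Fin 2) {h : E2 → ℝ} {x : E2} (hh : DifferentiableAt ℝ h x) :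
    pd i (fun y => y j * h y) x = (if j = i then h x else 0) + x j * pd i h x := by
  have h1 : HasFDerivAt (fun y : E2 => y j) (EuclideanSpace.proj j : E2 →L[ℝ] ℝ) x :=
    (EuclideanSpace.proj j : E2 →L[ℝ] ℝ).hasFDerivAt
  rw [pd, (HasFDerivAt.fun_mul h1 hh.hasFDerivAt).fderiv]
  simp [pd]
  split_ifs <;> ring

theorem pd_neg (i : Fin 2) (f : E2 → ℝ) (x : E2) : pd i (fun y => -f y) x = -pd i f x := by
  simp [pd, fderiv_fun_neg]

theorem pd_sub (i : Fin 2) {f g : E2 → ℝ} {x : E2} (hf : DifferentiableAt ℝ f x)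
    (hg : DifferentiableAt ℝ g x) : pd i (fun y => f y - g y) x = pd i f x - pd i g x := by
  simp [pd, fderiv_fun_sub hf hg]

theorem contDiff_pd {f : E2 → ℝ} (hf : ContDiff ℝ 2 f) (i : Fin 2) : ContDiff ℝ 1 (pd i f) :=
  (hf.fderiv_right (m := 1) (by norm_num)).clm_apply contDiff_const

theorem pd_comm {f : E2 → ℝ} (hf : ContDiff ℝ 2 f) (x : E2) :
    pd 0 (pd 1 f) x = pd 1 (pd 0 f) x := by
  have hd : DifferentiableAt ℝ (fderiv ℝ f) x :=
    (hf.fderiv_right (m := 1) (by norm_num)).differentiable (by simp) x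
  have h : ∀ i j, pd i (pd j f) x
      = fderiv ℝ (fderiv ℝ f) x (EuclideanSpace.single i 1) (EuclideanSpace.single j 1) := by
    intro i j
    rw [pd, show pd j f = fun y => fderiv ℝ f y (EuclideanSpace.single j 1) from rfl,
      (hd.hasFDerivAt.clm_apply (hasFDerivAt_const _ x)).fderiv]
    simp
  rw [h, h]
  exact (hf.contDiffAt.isSymmSndFDerivAt (by simp)) _ _

theorem Filter.EventuallyEq.pd_eq {f g : E2 → ℝ} {x : E2} (h : f =ᶠ[𝓝 x] g) (i : Fin 2) :
    pd i f x = pd i g x := by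
  rw [pd, pd, h.fderiv_eq]

/-- A smooth cutoff vanishing on the unit disc and equal to `1` for `2 ≤ ‖x‖ ^ 2`. -/
def cutoff (x : E2) : ℝ := Real.smoothTransition (‖x‖ ^ 2 - 1)

/-- The gauge function removing the angular dependence of the Poincaré potential at infinity. -/
def gaugeFunction (B : E2 → ℝ) (α : ℝ) (x : E2) : ℝ := cutoff x * planarPotential B α x

/-- The Poincaré potential of `B` corrected by the gradient of `gaugeFunction B α`. -/
def vectorPotential (B : E2 → ℝ) (α : ℝ) (x : E2) : E2 :=
  mk2 (-(x 1 * radialMoment B (Ioc 0 1) x) - pd 0 (gaugeFunction B α) x)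
    (x 0 * radialMoment B (Ioc 0 1) x - pd 1 (gaugeFunction B α) x)

theorem contDiff_cutoff : ContDiff ℝ 2 cutoff :=
  (Real.smoothTransition.contDiff (n := 2)).comp ((contDiff_norm_sq ℝ).sub contDiff_const)

theorem norm_rot (x : E2) : ‖rot x‖ = ‖x‖ := by
  refine (pow_left_inj₀ (norm_nonneg _) (norm_nonneg _) two_ne_zero).1 ?_
  simp [E2.norm_sq_eq, rot]
  ring

theorem tendsto_cube_mul_zero {f : E2 → ℝ} {s c : ℝ} (hs : 4 < s)
    (hf : ∀ x : E2, 2 < ‖x‖ → ‖f x‖ ≤ c * ‖x‖ ^ (1 - s)) :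
    Tendsto (fun x : E2 => (1 + ‖x‖) ^ 3 * f x) (cocompact E2) (𝓝 0) := by
  have hnorm := tendsto_norm_cocompact_atTop (E := E2)
  have hlim : Tendsto (fun x : E2 => 8 * c * ‖x‖ ^ (-(s - 4))) (cocompact E2) (𝓝 0) := by
    simpa using ((tendsto_rpow_neg_atTop (sub_pos.2 hs)).comp hnorm).const_mul (8 * c)
  refine squeeze_zero_norm' ?_ hlim
  filter_upwards [hnorm.eventually_gt_atTop 2] with x hx
  have hx0 : 0 < ‖x‖ := by linarith
  rw [norm_mul, norm_pow, Real.norm_of_nonneg (by positivity : 0 ≤ 1 + ‖x‖)]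
  calc (1 + ‖x‖) ^ 3 * ‖f x‖ ≤ (2 * ‖x‖) ^ 3 * (c * ‖x‖ ^ (1 - s)) := by
        gcongr
        · linarith
        · exact hf x hx
    _ = 8 * c * (‖x‖ ^ (3 : ℝ) * ‖x‖ ^ (1 - s)) := by norm_cast; ring
    _ = _ := by
      rw [← Real.rpow_add hx0]
      congr 2
      ring

namespace DecaysC1

variable {B : E2 → ℝ} {s C α : ℝ}

theorem contDiff_gauge (h : DecaysC1 B s C) (hα : α = (1 / (2 * π)) * ∫ x, B x) :
    ContDiff ℝ 2 (gaugeFunction B α) := contDiff_iff_contDiffAt.2 fun x => by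
  by_cases hx : x = 0
  · refine (contDiffAt_const (c := (0 : ℝ))).congr_of_eventuallyEq ?_
    have : {y : E2 | ‖y‖ < 1} ∈ 𝓝 x :=
      (isOpen_lt continuous_norm continuous_const).mem_nhds (by simp [hx])
    filter_upwards [this] with y hy
    have hy' : ‖y‖ ^ 2 ≤ 1 := pow_le_one₀ (norm_nonneg y) (le_of_lt hy)
    rw [gaugeFunction, cutoff, Real.smoothTransition.zero_of_nonpos (by linarith), zero_mul]
  · exact contDiff_cutoff.contDiffAt.mul (h.contDiffAt_planarPotential hα hx)

theorem gauge_eventuallyEq {x : E2} (hx : 2 < ‖x‖) :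
    gaugeFunction B α =ᶠ[𝓝 x] planarPotential B α := by
  filter_upwards [(isOpen_lt continuous_const continuous_norm).mem_nhds hx] with y hy
  have hy' : 2 < ‖y‖ := hy
  rw [gaugeFunction, cutoff, Real.smoothTransition.one_of_one_le (by nlinarith), one_mul]

theorem contDiff_vectorPotential (h : DecaysC1 B s C) (hα : α = (1 / (2 * π)) * ∫ x, B x) :
    ContDiff ℝ 1 (vectorPotential B α) := by
  have hP := h.contDiff_radialMoment_unit
  have h0 := contDiff_pd (h.contDiff_gauge hα) 0
  have h1 := contDiff_pd (h.contDiff_gauge hα) 1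
  refine contDiff_euclidean.2 fun i => ?_
  fin_cases i <;> simp [vectorPotential] <;> fun_prop

theorem curl_vectorPotential (h : DecaysC1 B s C) (hα : α = (1 / (2 * π)) * ∫ x, B x) (x : E2) :
    pd 0 (fun y => vectorPotential B α y 1) x - pd 1 (fun y => vectorPotential B α y 0) x
      = B x := by
  have hP : DifferentiableAt ℝ (radialMoment B (Ioc 0 1)) x :=
    h.contDiff_radialMoment_unit.differentiable (by simp) x
  have hg := h.contDiff_gauge hα
  have hg' : ∀ i, DifferentiableAt ℝ (pd i (gaugeFunction B α)) x := fun i =>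
    (contDiff_pd hg i).differentiable (by simp) x
  simp only [vectorPotential, mk2_apply_zero, mk2_apply_one]
  rw [pd_sub 0 (by fun_prop) (hg' 1), pd_sub 1 (by fun_prop) (hg' 0), pd_neg, pd_coord_mul _ _ hP,
    pd_coord_mul _ _ hP, pd_comm hg, ← h.two_mul_radialMoment_unit x, fderiv_apply_eq_pd]
  simp
  ring

theorem pd_gauge_far (h : DecaysC1 B s C) (hα : α = (1 / (2 * π)) * ∫ x, B x) {x : E2}
    (hx : 2 < ‖x‖) (i : Fin 2) :
    pd i (gaugeFunction B α) x = (radialMoment B (Ioi 0) x - α / ‖x‖ ^ 2) * rot x i := by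
  have hx0 : x ≠ 0 := norm_pos_iff.1 (by linarith)
  rw [(gauge_eventuallyEq hx).pd_eq, pd, (h.hasFDerivAt_planarPotential hα hx0).fderiv]
  simp [EuclideanSpace.inner_single_right]

theorem vectorPotential_far (h : DecaysC1 B s C) (hα : α = (1 / (2 * π)) * ∫ x, B x) {x : E2}
    (hx : 2 < ‖x‖) :
    vectorPotential B α x = (α / ‖x‖ ^ 2 - radialMoment B (Ioi 1) x) • rot x := by
  have hx0 : x ≠ 0 := norm_pos_iff.1 (by linarith)
  ext i
  fin_cases i <;>
    simp [vectorPotential, h.pd_gauge_far hα hx, h.radialMoment_Ioi_zero hx0, rot] <;> ring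

theorem norm_vectorPotential_sub_A0_le (h : DecaysC1 B s C)
    (hα : α = (1 / (2 * π)) * ∫ x, B x) {x : E2} (hx : 2 < ‖x‖) :
    ‖vectorPotential B α x - A0 α x‖ ≤
      C * (∫ t in Ioi (1 : ℝ), t ^ (1 - s)) * ‖x‖ ^ (1 - s) := by
  have hx0 : x ≠ 0 := norm_pos_iff.1 (by linarith)
  have hA0 : A0 α x = (α / ‖x‖ ^ 2) • rot x := by
    rw [A0, if_neg hx0, if_neg (by linarith)]
    rfl
  rw [h.vectorPotential_far hα hx, hA0, ← sub_smul, sub_sub_cancel_left, norm_smul, norm_neg,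
    norm_rot]
  refine (mul_le_mul_of_nonneg_right (h.norm_radialMoment_far_le hx0) (norm_nonneg x)).trans_eq ?_
  rw [mul_assoc, ← Real.rpow_add_one (norm_ne_zero_iff.2 hx0), neg_add_eq_sub]

theorem div_vectorPotential_far (h : DecaysC1 B s C) (hα : α = (1 / (2 * π)) * ∫ x, B x) {x : E2}
    (hx : 2 < ‖x‖) :
    pd 0 (fun y => vectorPotential B α y 0) x + pd 1 (fun y => vectorPotential B α y 1) x
      = -fderiv ℝ (radialMoment B (Ioi 1)) x (rot x) := by
  have hx0 : x ≠ 0 := norm_pos_iff.1 (by linarith)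
  have hnear : ∀ᶠ y in 𝓝 x, 2 < ‖y‖ :=
    (isOpen_lt continuous_const continuous_norm).mem_nhds hx
  have hF : DifferentiableAt ℝ (radialMoment B (Ioi 1)) x :=
    (h.radialMoment_hasFDerivAt measurableSet_Ioi (Ioi_subset_Ioi zero_le_one)
      hx0).1.differentiableAt
  have hN : HasFDerivAt (fun y : E2 => ‖y‖ ^ 2) (2 • innerSL ℝ x) x :=
    (hasStrictFDerivAt_norm_sq x).hasFDerivAt
  have hinv : HasFDerivAt (fun y : E2 => α / ‖y‖ ^ 2)
      ((-(α / (‖x‖ ^ 2) ^ 2)) • (2 • innerSL ℝ x)) x := by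
    have h1 : HasDerivAt (fun r : ℝ => α / r) (-(α / (‖x‖ ^ 2) ^ 2)) (‖x‖ ^ 2) := by
      refine ((hasDerivAt_inv (by simpa using hx0)).const_mul α).congr_deriv ?_
      ring
    exact h1.comp_hasFDerivAt x hN
  have hg := hinv.fun_sub hF.hasFDerivAt
  have hgd : DifferentiableAt ℝ (fun y : E2 => α / ‖y‖ ^ 2 - radialMoment B (Ioi 1) y) x :=
    hg.differentiableAt
  have e0 : (fun y => vectorPotential B α y 0) =ᶠ[𝓝 x]
      fun y => -(y 1 * (α / ‖y‖ ^ 2 - radialMoment B (Ioi 1) y)) := by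
    filter_upwards [hnear] with y hy
    rw [h.vectorPotential_far hα hy]
    simp [rot]
    ring
  have e1 : (fun y => vectorPotential B α y 1) =ᶠ[𝓝 x]
      fun y => y 0 * (α / ‖y‖ ^ 2 - radialMoment B (Ioi 1) y) := by
    filter_upwards [hnear] with y hy
    rw [h.vectorPotential_far hα hy]
    simp [rot]
    ring
  have hdiv := fderiv_apply_eq_pd (fun y : E2 => α / ‖y‖ ^ 2 - radialMoment B (Ioi 1) y) x (rot x)
  have hrad : inner ℝ x (rot x) = 0 := by
    rw [real_inner_comm, inner_rot]
    ring
  have hval : fderiv ℝ (fun y : E2 => α / ‖y‖ ^ 2 - radialMoment B (Ioi 1) y) x (rot x)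
      = -fderiv ℝ (radialMoment B (Ioi 1)) x (rot x) := by
    rw [hg.fderiv]
    simp [hrad]
  rw [e0.pd_eq, e1.pd_eq, pd_neg, pd_coord_mul _ _ hgd, pd_coord_mul _ _ hgd, ← hval, hdiv]
  simp [rot]

theorem norm_div_vectorPotential_le (h : DecaysC1 B s C) (hα : α = (1 / (2 * π)) * ∫ x, B x)
    {x : E2} (hx : 2 < ‖x‖) :
    ‖pd 0 (fun y => vectorPotential B α y 0) x + pd 1 (fun y => vectorPotential B α y 1) x‖ ≤
      C * (∫ t in Ioi (1 : ℝ), t ^ (1 - s)) * ‖x‖ ^ (1 - s) := by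
  have hx0 : x ≠ 0 := norm_pos_iff.1 (by linarith)
  have hI : 0 ≤ ∫ t in Ioi (1 : ℝ), t ^ (1 - s) :=
    setIntegral_nonneg measurableSet_Ioi fun t ht =>
      Real.rpow_nonneg (zero_le_one.trans (le_of_lt ht)) _
  have hC := h.nonneg
  rw [h.div_vectorPotential_far hα hx, norm_neg]
  calc ‖fderiv ℝ (radialMoment B (Ioi 1)) x (rot x)‖
      ≤ C * (∫ t in Ioi (1 : ℝ), t ^ (1 - s)) * ‖x‖ ^ (-s - 1) * ‖x‖ := by
        refine (ContinuousLinearMap.le_opNorm _ _).trans ?_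
        rw [norm_rot]
        gcongr
        exact h.norm_fderiv_radialMoment_far_le hx0
    _ = C * (∫ t in Ioi (1 : ℝ), t ^ (1 - s)) * ‖x‖ ^ (-s) := by
        rw [mul_assoc, ← Real.rpow_add_one (norm_ne_zero_iff.2 hx0), sub_add_cancel]
    _ ≤ _ := by
        gcongr
        · linarith
        · linarith

end DecaysC1

theorem stmt0 (B : E2 → ℝ) (hB : ContDiff ℝ (⊤ : ℕ∞) B)
    (hdecay : ∃ s : ℝ, 4 < s ∧ ∀ β : ℕ × ℕ, ∃ C : ℝ, 0 < C ∧ ∀ x : E2,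
      |pdMulti β B x| ≤ C * (1 + ‖x‖) ^ (-s - ((β.1 : ℝ) + (β.2 : ℝ))))
    (α : ℝ) (hα : α = (1 / (2 * π)) * ∫ x : E2, B x) (hα0 : α ≠ 0) :
    ∃ A : E2 → E2, ContDiff ℝ 1 A ∧
      (∀ x : E2, pd 0 (fun y => A y 1) x - pd 1 (fun y => A y 0) x = B x) ∧
      Tendsto (fun x : E2 => (1 + ‖x‖) ^ 3 *
          (pd 0 (fun y => A y 0) x + pd 1 (fun y => A y 1) x))
        (cocompact E2) (nhds 0) ∧
      Tendsto (fun x : E2 => (1 + ‖x‖) ^ 3 * ‖A x - A0 α x‖)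
        (cocompact E2) (nhds 0) := by
  obtain ⟨s, hs, hdecay⟩ := hdecay
  obtain ⟨C, h⟩ := exists_decaysC1 hB hs hdecay
  exact ⟨vectorPotential B α, h.contDiff_vectorPotential hα, h.curl_vectorPotential hα,
    tendsto_cube_mul_zero hs fun x hx => h.norm_div_vectorPotential_le hα hx,
    tendsto_cube_mul_zero hs fun x hx => by
      simpa only [norm_norm] using h.norm_vectorPotential_sub_A0_le hα hx⟩
end
end

section
/- Let B : ℝ² → ℝ be a smooth function for which there exists s > 4 such that for every multi-index β ∈ ℕ² there is a constant C_β > 0 with |∂^β B(x)| ≤ C_β (1+|x|)^{-s-|β|} for all x ∈ ℝ². Assume ∫_{ℝ²} B(x) dx = 0. Then there exists a continuously differentiable vector field A : ℝ² → ℝ² such that ∂₁A₂(x) − ∂₂A₁(x) = B(x) for all x ∈ ℝ², and such that (1+|x|)³ (∂₁A₁(x) + ∂₂A₂(x)) → 0 and (1+|x|)³ |A(x)| → 0 as |x| → ∞. -/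
open scoped Real
open Filter

noncomputable section

open MeasureTheory Set

/-! ### One-dimensional tail estimates -/

lemma integrableOn_Ioi_const_add_rpow {s c : ℝ} (hs : 1 < s) (hc : 0 < c) :
    IntegrableOn (fun t : ℝ => (c + t) ^ (-s)) (Ioi 0) := by
  simpa only [add_comm] using
    integrableOn_add_rpow_Ioi_of_lt (a := -s) (c := 0) (m := c) (by linarith) (by linarith)

lemma setIntegral_Ioi_shift (f : ℝ → ℝ) (a : ℝ) :
    ∫ t in Ioi 0, f (a + t) = ∫ t in Ioi a, f t := by
  have := (measurePreserving_add_left volume a).setIntegral_preimage_emb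
    (measurableEmbedding_addLeft a) f (Ioi a)
  simpa using this

lemma setIntegral_Iic_shift (f : ℝ → ℝ) (a : ℝ) :
    ∫ t in Iic 0, f (a + t) = ∫ t in Iic a, f t := by
  have := (measurePreserving_add_left volume a).setIntegral_preimage_emb
    (measurableEmbedding_addLeft a) f (Iic a)
  simpa using this

lemma integral_Ioi_const_add_rpow {s c : ℝ} (hs : 1 < s) (hc : 0 < c) :
    ∫ t in Ioi 0, (c + t) ^ (-s) = c ^ (1 - s) / (s - 1) := by
  rw [setIntegral_Ioi_shift (fun t => t ^ (-s)) c, integral_Ioi_rpow_of_lt (by linarith) hc,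
    show -s + 1 = 1 - s by ring, neg_div, ← div_neg, neg_sub]

lemma integrable_add_abs_rpow {s c : ℝ} (hs : 1 < s) (hc : 1 ≤ c) :
    Integrable (fun t : ℝ => (c + |t|) ^ (-s)) := by
  have h : Integrable (fun t : ℝ => (1 + ‖t‖) ^ (-s)) := integrable_one_add_norm (by simpa using hs)
  refine h.mono' (Measurable.aestronglyMeasurable (by fun_prop)) (ae_of_all _ fun t => ?_)
  rw [Real.norm_eq_abs, abs_of_nonneg (by positivity)]
  exact Real.rpow_le_rpow_of_nonpos (by positivity) (by simpa using hc) (by linarith)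

lemma integral_add_abs_rpow {s c : ℝ} (hs : 1 < s) (hc : 0 < c) :
    ∫ t : ℝ, (c + |t|) ^ (-s) = 2 * (c ^ (1 - s) / (s - 1)) := by
  rw [integral_comp_abs (f := fun t => (c + t) ^ (-s)), integral_Ioi_const_add_rpow hs hc]

section Tail

variable {f : ℝ → ℝ} {K s c : ℝ}

lemma integrable_of_decay (hs : 1 < s) (hc : 1 ≤ c) (hf : Continuous f)
    (hb : ∀ t, |f t| ≤ K * (c + |t|) ^ (-s)) : Integrable f :=
  ((integrable_add_abs_rpow hs hc).const_mul K).mono' hf.aestronglyMeasurable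
    (ae_of_all _ fun t => hb t)

lemma abs_setIntegral_le_of_decay (hs : 1 < s) (hc : 1 ≤ c) (hf : Continuous f)
    (hb : ∀ t, |f t| ≤ K * (c + |t|) ^ (-s)) (S : Set ℝ) :
    |∫ t in S, f t| ≤ 2 * K * c ^ (1 - s) / (s - 1) := by
  have hi := integrable_of_decay hs hc hf hb
  calc |∫ t in S, f t| ≤ ∫ t in S, |f t| := abs_integral_le_integral_abs
    _ ≤ ∫ t, |f t| := setIntegral_le_integral hi.abs (ae_of_all _ fun t => abs_nonneg _)
    _ ≤ ∫ t, K * (c + |t|) ^ (-s) :=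
        integral_mono hi.abs ((integrable_add_abs_rpow hs hc).const_mul K) hb
    _ = _ := by rw [integral_const_mul, integral_add_abs_rpow hs (by linarith)]; ring

lemma abs_integral_Ioi_le_of_decay (hs : 1 < s) (hc : 1 ≤ c) (hf : Continuous f)
    (hb : ∀ t, |f t| ≤ K * (c + |t|) ^ (-s)) {a : ℝ} (ha : 0 ≤ a) :
    |∫ t in Ioi a, f t| ≤ K * (c + |a|) ^ (1 - s) / (s - 1) := by
  have hi := integrable_of_decay hs hc hf hb
  have hca : 0 < c + a := by linarith
  have hmajor := (integrableOn_Ioi_const_add_rpow hs hca).const_mul K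
  rw [← setIntegral_Ioi_shift]
  calc |∫ t in Ioi 0, f (a + t)| ≤ ∫ t in Ioi 0, |f (a + t)| := abs_integral_le_integral_abs
    _ ≤ ∫ t in Ioi 0, K * (c + a + t) ^ (-s) := by
        refine setIntegral_mono_on (hi.comp_add_left a).abs.integrableOn hmajor measurableSet_Ioi
          fun t ht => ?_
        have ht : 0 < t := ht
        have := hb (a + t)
        rwa [abs_of_nonneg (by linarith : 0 ≤ a + t), ← add_assoc] at this
    _ = _ := by
        rw [integral_const_mul, integral_Ioi_const_add_rpow hs hca, abs_of_nonneg ha]; ring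

lemma abs_integral_Iic_le_of_decay (hs : 1 < s) (hc : 1 ≤ c) (hf : Continuous f)
    (hb : ∀ t, |f t| ≤ K * (c + |t|) ^ (-s)) {a : ℝ} (ha : a ≤ 0) :
    |∫ t in Iic a, f t| ≤ K * (c + |a|) ^ (1 - s) / (s - 1) := by
  have := abs_integral_Ioi_le_of_decay (f := fun t => f (-t)) hs hc (hf.comp continuous_neg)
    (fun t => by simpa using hb (-t)) (neg_nonneg.2 ha)
  rwa [integral_comp_neg_Ioi, neg_neg, abs_neg] at this

lemma abs_integral_Iic_le_of_decay_of_integral_eq_zero (hs : 1 < s) (hc : 1 ≤ c)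
    (hf : Continuous f) (hb : ∀ t, |f t| ≤ K * (c + |t|) ^ (-s)) (h0 : ∫ t, f t = 0) (a : ℝ) :
    |∫ t in Iic a, f t| ≤ K * (c + |a|) ^ (1 - s) / (s - 1) := by
  rcases le_total a 0 with ha | ha
  · exact abs_integral_Iic_le_of_decay hs hc hf hb ha
  · have hi := integrable_of_decay hs hc hf hb
    have := intervalIntegral.integral_Iic_add_Ioi (b := a) hi.integrableOn hi.integrableOn
    rw [h0] at this
    rw [eq_neg_of_add_eq_zero_left this, abs_neg]
    exact abs_integral_Ioi_le_of_decay hs hc hf hb ha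

lemma hasDerivAt_integral_Iic (hf : Continuous f) (hi : Integrable f) (a : ℝ) :
    HasDerivAt (fun x => ∫ t in Iic x, f t) (f a) a := by
  have h : (fun x => ∫ t in Iic x, f t) = fun x => (∫ t in Iic 0, f t) + ∫ t in (0 : ℝ)..x, f t := by
    funext x
    rw [← intervalIntegral.integral_Iic_sub_Iic hi.integrableOn hi.integrableOn]; ring
  rw [h]
  exact (intervalIntegral.integral_hasDerivAt_right (hf.intervalIntegrable _ _)
    (hf.stronglyMeasurableAtFilter _ _) hf.continuousAt).const_add _

lemma tendsto_cocompact_of_decay (hs : 0 < s)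
    (hb : ∀ t, |f t| ≤ K * (c + |t|) ^ (-s)) : Tendsto f (cocompact ℝ) (nhds 0) := by
  have h1 : Tendsto (fun t : ℝ => c + |t|) (cocompact ℝ) atTop :=
    tendsto_atTop_add_const_left _ _ (tendsto_norm_cocompact_atTop (E := ℝ))
  have h2 := ((tendsto_rpow_neg_atTop hs).comp h1).const_mul K
  rw [mul_zero] at h2
  exact squeeze_zero_norm hb h2

end Tail

/-! ### Functions on the plane with prescribed gradient -/

/-- `F` is differentiable everywhere, with partial derivatives `a` and `b`. -/
def HasGrad (F a b : E2 → ℝ) : Prop :=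
  ∀ z, HasFDerivAt F (a z • (EuclideanSpace.proj 0 : E2 →L[ℝ] ℝ) +
    b z • (EuclideanSpace.proj 1 : E2 →L[ℝ] ℝ)) z

namespace HasGrad

variable {F G a b a' b' : E2 → ℝ}

lemma congr_grad (h : HasGrad F a b) (ha : ∀ z, a z = a' z) (hb : ∀ z, b z = b' z) :
    HasGrad F a' b' := by
  rwa [← funext ha, ← funext hb]

lemma pd_zero (h : HasGrad F a b) (z : E2) : pd 0 F z = a z := by
  simp [pd, (h z).fderiv]

lemma pd_one (h : HasGrad F a b) (z : E2) : pd 1 F z = b z := by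
  simp [pd, (h z).fderiv]

lemma continuous (h : HasGrad F a b) : Continuous F :=
  continuous_iff_continuousAt.2 fun z => (h z).continuousAt

lemma contDiff_one (h : HasGrad F a b) (ha : Continuous a) (hb : Continuous b) :
    ContDiff ℝ 1 F := by
  refine contDiff_one_iff_fderiv.2 ⟨fun z => (h z).differentiableAt, ?_⟩
  rw [funext fun z => (h z).fderiv]
  fun_prop

lemma of_contDiff (h : ContDiff ℝ 1 F) : HasGrad F (pd 0 F) (pd 1 F) := by
  intro z
  refine HasFDerivAt.congr_fderiv ((h.differentiable one_ne_zero z).hasFDerivAt) ?_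
  apply ContinuousLinearMap.ext; intro v
  have hv : v = v 0 • EuclideanSpace.single 0 (1 : ℝ) + v 1 • EuclideanSpace.single 1 (1 : ℝ) := by
    ext i; fin_cases i <;> simp
  conv_lhs => rw [hv, map_add, map_smul, map_smul]
  simp [pd, mul_comm]

lemma neg (h : HasGrad F a b) : HasGrad (fun z => -F z) (fun z => -a z) (fun z => -b z) := by
  intro z
  refine HasFDerivAt.congr_fderiv ((h z).neg) ?_
  apply ContinuousLinearMap.ext; intro v
  simp; ring

lemma sub (h : HasGrad F a b) (h' : HasGrad G a' b') :
    HasGrad (fun z => F z - G z) (fun z => a z - a' z) (fun z => b z - b' z) := by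
  intro z
  refine HasFDerivAt.congr_fderiv ((h z).sub (h' z)) ?_
  apply ContinuousLinearMap.ext; intro v
  simp; ring

lemma mul (h : HasGrad F a b) (h' : HasGrad G a' b') :
    HasGrad (fun z => F z * G z) (fun z => a z * G z + F z * a' z)
      (fun z => b z * G z + F z * b' z) := by
  intro z
  refine HasFDerivAt.congr_fderiv ((h z).mul (h' z)) ?_
  apply ContinuousLinearMap.ext; intro v
  simp; ring

lemma comp {f f' : ℝ → ℝ} (hf : ∀ x, HasDerivAt f (f' x) x) (h : HasGrad F a b) :
    HasGrad (fun z => f (F z)) (fun z => f' (F z) * a z) (fun z => f' (F z) * b z) := by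
  intro z
  refine HasFDerivAt.congr_fderiv ((hf (F z)).comp_hasFDerivAt z (h z)) ?_
  apply ContinuousLinearMap.ext; intro v
  simp; ring

end HasGrad

lemma hasGrad_coord_zero : HasGrad (fun z => z 0) (fun _ => 1) (fun _ => 0) := by
  intro z
  simpa using (EuclideanSpace.proj 0 : E2 →L[ℝ] ℝ).hasFDerivAt (x := z)

lemma hasGrad_coord_one : HasGrad (fun z => z 1) (fun _ => 0) (fun _ => 1) := by
  intro z
  simpa using (EuclideanSpace.proj 1 : E2 →L[ℝ] ℝ).hasFDerivAt (x := z)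

/-! ### Integrals along horizontal lines -/

/-- An `ℓ¹` version of the weight `1 + ‖z‖`. -/
def weight (z : E2) : ℝ := 1 + |z 0| + |z 1|

lemma one_le_weight (z : E2) : 1 ≤ weight z := by
  have := abs_nonneg (z 0); have := abs_nonneg (z 1); unfold weight; linarith

/-- The integral of `G` over the part of the horizontal line through `z` with offset in `S`. -/
def lineInt (S : Set ℝ) (G : E2 → ℝ) (z : E2) : ℝ :=
  ∫ t in S, G (z + t • EuclideanSpace.single 0 1)

/-- The restriction of `G` to a horizontal line. -/
def horiz (G : E2 → ℝ) (y t : ℝ) : ℝ := G !₂[t, y]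

lemma continuous_horiz {G : E2 → ℝ} (hG : Continuous G) (y : ℝ) : Continuous (horiz G y) := by
  unfold horiz; fun_prop

lemma add_smul_single (z : E2) (t : ℝ) :
    z + t • EuclideanSpace.single 0 (1 : ℝ) = !₂[z 0 + t, z 1] := by
  ext i; fin_cases i <;> simp

lemma lineInt_Iic (G : E2 → ℝ) (z : E2) :
    lineInt (Iic 0) G z = ∫ t in Iic (z 0), horiz G (z 1) t := by
  rw [← setIntegral_Iic_shift]
  simp only [lineInt, add_smul_single, horiz]

lemma lineInt_univ (G : E2 → ℝ) (z : E2) :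
    lineInt univ G z = ∫ t, horiz G (z 1) t := by
  simp only [lineInt, add_smul_single, setIntegral_univ]
  exact integral_add_left_eq_self (horiz G (z 1)) (z 0)

section LineInt

variable {G a b : E2 → ℝ} {K s : ℝ}

lemma abs_horiz_le (hb : ∀ z, |G z| ≤ K * weight z ^ (-s)) (y t : ℝ) :
    |horiz G y t| ≤ K * (1 + |y| + |t|) ^ (-s) := by
  simpa [horiz, weight, add_right_comm] using hb !₂[t, y]

lemma integrable_horiz (hs : 1 < s) (hG : Continuous G)
    (hb : ∀ z, |G z| ≤ K * weight z ^ (-s)) (y : ℝ) : Integrable (horiz G y) :=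
  integrable_of_decay hs (by simp) (continuous_horiz hG y) (abs_horiz_le hb y)

lemma nonneg_of_decay (hb : ∀ z, |G z| ≤ K * weight z ^ (-s)) : 0 ≤ K := by
  have := (abs_nonneg _).trans (hb 0)
  simpa [weight] using this

lemma abs_line_le_of_dist_lt (hs : 0 ≤ s) (hb : ∀ z, |G z| ≤ K * weight z ^ (-s))
    {z w : E2} (hw : dist w z < 1) (t : ℝ) :
    |G (w + t • EuclideanSpace.single 0 1)| ≤ K * (2 ^ s * (1 + |z 0 + t|) ^ (-s)) := by
  refine (hb _).trans (mul_le_mul_of_nonneg_left ?_ (nonneg_of_decay hb))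
  have h1 : |w 0 - z 0| ≤ 1 := by
    have := PiLp.norm_apply_le (w - z) 0
    rw [dist_eq_norm] at hw
    simpa using this.trans hw.le
  have h2 : (1 + |z 0 + t|) / 2 ≤ weight (w + t • EuclideanSpace.single 0 1) := by
    rw [add_smul_single]
    have h3 := abs_add_le (w 0 + t) (z 0 - w 0)
    rw [show w 0 + t + (z 0 - w 0) = z 0 + t by ring, abs_sub_comm] at h3
    have := abs_nonneg (w 0 + t); have := abs_nonneg (w 1)
    simp only [weight]
    simp
    linarith
  calc weight (w + t • EuclideanSpace.single 0 1) ^ (-s) ≤ ((1 + |z 0 + t|) / 2) ^ (-s) :=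
        Real.rpow_le_rpow_of_nonpos (by positivity) h2 (by linarith)
    _ = _ := by
        rw [Real.div_rpow (by positivity) (by norm_num), Real.rpow_neg (by norm_num : (0 : ℝ) ≤ 2)]
        field_simp

lemma integrable_dominant (hs : 1 < s) (x : ℝ) (S : Set ℝ) :
    IntegrableOn (fun t => K * (2 ^ s * (1 + |x + t|) ^ (-s))) S :=
  ((((integrable_add_abs_rpow hs le_rfl).comp_add_left x).const_mul (2 ^ s)).const_mul K).integrableOn

lemma continuous_lineInt (hs : 1 < s) (hG : Continuous G)
    (hb : ∀ z, |G z| ≤ K * weight z ^ (-s)) (S : Set ℝ) : Continuous (lineInt S G) := by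
  refine continuous_iff_continuousAt.2 fun z => ?_
  refine continuousAt_of_dominated (bound := fun t => K * (2 ^ s * (1 + |z 0 + t|) ^ (-s)))
    ?_ ?_ (integrable_dominant hs _ S) ?_
  · exact Eventually.of_forall fun w => Continuous.aestronglyMeasurable (by fun_prop)
  · filter_upwards [Metric.ball_mem_nhds z one_pos] with w hw
    exact ae_of_all _ fun t => abs_line_le_of_dist_lt (by linarith) hb hw t
  · exact ae_of_all _ fun t => by fun_prop

lemma integrableOn_line (hs : 1 < s) (hG : Continuous G)
    (hb : ∀ z, |G z| ≤ K * weight z ^ (-s)) (S : Set ℝ) (z : E2) :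
    IntegrableOn (fun t : ℝ => G (z + t • EuclideanSpace.single 0 1)) S :=
  (integrable_dominant hs (z 0) S).mono' (Continuous.aestronglyMeasurable (by fun_prop))
    (ae_of_all _ fun t => abs_line_le_of_dist_lt (by linarith) hb (by simp) t)

lemma HasGrad.lineInt (hs : 1 < s) (h : HasGrad G a b) (hca : Continuous a) (hcb : Continuous b)
    (hG : ∀ z, |G z| ≤ K * weight z ^ (-s)) (ha : ∀ z, |a z| ≤ K * weight z ^ (-s))
    (hb : ∀ z, |b z| ≤ K * weight z ^ (-s)) (S : Set ℝ) :
    HasGrad (lineInt S G) (lineInt S a) (lineInt S b) := by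
  intro z
  have hcG := h.continuous
  set e : E2 := EuclideanSpace.single 0 1
  set p : E2 →L[ℝ] ℝ := EuclideanSpace.proj 0
  set q : E2 →L[ℝ] ℝ := EuclideanSpace.proj 1
  have key := hasFDerivAt_integral_of_dominated_of_fderiv_le (μ := volume.restrict S) (𝕜 := ℝ)
    (F := fun w t => G (w + t • e)) (x₀ := z) (s := Metric.ball z 1)
    (F' := fun w t => a (w + t • e) • p + b (w + t • e) • q)
    (bound := fun t => K * (2 ^ s * (1 + |z 0 + t|) ^ (-s)) * ‖p‖ +
      K * (2 ^ s * (1 + |z 0 + t|) ^ (-s)) * ‖q‖)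
    (Metric.ball_mem_nhds z one_pos)
    (Eventually.of_forall fun w => Continuous.aestronglyMeasurable (by fun_prop))
    (integrableOn_line hs hcG hG S z)
    (Continuous.aestronglyMeasurable (by fun_prop))
    (ae_of_all _ fun t w hw => by
      refine (norm_add_le _ _).trans (add_le_add ?_ ?_)
      · rw [norm_smul]
        exact mul_le_mul_of_nonneg_right (abs_line_le_of_dist_lt (by linarith) ha hw t)
          (norm_nonneg _)
      · rw [norm_smul]
        exact mul_le_mul_of_nonneg_right (abs_line_le_of_dist_lt (by linarith) hb hw t)
          (norm_nonneg _))
    (((integrable_dominant hs _ S).mul_const _).add ((integrable_dominant hs _ S).mul_const _))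
    (ae_of_all _ fun t w hw => (hasFDerivAt_comp_add_right (t • e)).2 (h (w + t • e)))
  rw [integral_add ((integrableOn_line hs hca ha S z).smul_const p)
    ((integrableOn_line hs hcb hb S z).smul_const q), integral_smul_const,
    integral_smul_const] at key
  exact key

lemma HasGrad.hasDerivAt_horiz (h : HasGrad G a b) (y t : ℝ) :
    HasDerivAt (horiz G y) (horiz a y t) t := by
  unfold horiz
  have h1 : HasDerivAt (fun t : ℝ => (!₂[0, y] : E2) + t • EuclideanSpace.single 0 (1 : ℝ))
      (EuclideanSpace.single 0 1) t := by
    simpa using ((hasDerivAt_id t).smul_const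
      (EuclideanSpace.single 0 (1 : ℝ) : E2)).const_add (!₂[0, y] : E2)
  have h2 := (h ((!₂[0, y] : E2) + t • EuclideanSpace.single 0 1)).comp_hasDerivAt t h1
  simp only [add_smul_single, Function.comp_def] at h2
  simpa [horiz, Function.comp_def] using h2

lemma HasGrad.lineInt_Iic_eq (hs : 1 < s) (h : HasGrad G a b) (hca : Continuous a)
    (hG : ∀ z, |G z| ≤ K * weight z ^ (-s)) (ha : ∀ z, |a z| ≤ K * weight z ^ (-s)) (z : E2) :
    _root_.lineInt (Iic 0) a z = G z := by
  have ht := tendsto_cocompact_of_decay (by linarith) (abs_horiz_le hG (z 1))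
  rw [lineInt_Iic, integral_Iic_of_hasDerivAt_of_tendsto
    (continuous_horiz h.continuous (z 1)).continuousWithinAt
    (fun t _ => h.hasDerivAt_horiz (z 1) t) (integrable_horiz hs hca ha _).integrableOn
    (ht.mono_left atBot_le_cocompact), sub_zero, horiz]
  congr 1
  ext i; fin_cases i <;> simp

lemma HasGrad.lineInt_univ_eq_zero (hs : 1 < s) (h : HasGrad G a b) (hca : Continuous a)
    (hG : ∀ z, |G z| ≤ K * weight z ^ (-s)) (ha : ∀ z, |a z| ≤ K * weight z ^ (-s)) (z : E2) :
    _root_.lineInt univ a z = 0 := by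
  have ht := tendsto_cocompact_of_decay (by linarith) (abs_horiz_le hG (z 1))
  rw [lineInt_univ, integral_of_hasDerivAt_of_tendsto (fun t => h.hasDerivAt_horiz (z 1) t)
    (integrable_horiz hs hca ha _) (ht.mono_left atBot_le_cocompact)
    (ht.mono_left atTop_le_cocompact), sub_zero]

end LineInt

lemma abs_lineInt_univ_le {G : E2 → ℝ} {K s : ℝ} (hs : 1 < s) (hG : Continuous G)
    (hb : ∀ z, |G z| ≤ K * weight z ^ (-s)) (z : E2) :
    |lineInt univ G z| ≤ 2 * K / (s - 1) * (1 + |z 1|) ^ (1 - s) := by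
  rw [lineInt_univ]
  have := abs_setIntegral_le_of_decay hs (by simp) (continuous_horiz hG (z 1))
    (abs_horiz_le hb (z 1)) univ
  rw [setIntegral_univ] at this
  exact this.trans_eq (by ring)

lemma one_add_norm_le_weight (z : E2) : 1 + ‖z‖ ≤ weight z := by
  rw [weight, add_assoc]
  gcongr
  rw [EuclideanSpace.norm_eq, Fin.sum_univ_two, Real.sqrt_le_left (by positivity)]
  simp only [Real.norm_eq_abs]
  nlinarith [mul_nonneg (abs_nonneg (z 0)) (abs_nonneg (z 1))]

lemma integrable_of_weight_decay {G : E2 → ℝ} {K s : ℝ} (hs : 2 < s) (hG : Continuous G)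
    (hb : ∀ z, |G z| ≤ K * weight z ^ (-s)) : Integrable G := by
  have h : Integrable (fun z : E2 => (1 + ‖z‖) ^ (-s)) := integrable_one_add_norm (by simpa using hs)
  refine (h.const_mul K).mono' hG.aestronglyMeasurable (ae_of_all _ fun z => (hb z).trans ?_)
  refine mul_le_mul_of_nonneg_left ?_ (nonneg_of_decay hb)
  refine Real.rpow_le_rpow_of_nonpos (by positivity) (one_add_norm_le_weight z) (by linarith)

lemma integral_eq_integral_horiz {G : E2 → ℝ} (hG : Integrable G) :
    ∫ z, G z = ∫ y, ∫ t, horiz G y t := by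
  have h1 := (volume_preserving_finTwoArrow ℝ).symm
  have h2 := (EuclideanSpace.volume_preserving_symm_measurableEquiv_toLp (Fin 2)).symm
  have hmp := h2.comp h1
  have hemb := (MeasurableEquiv.toLp 2 (Fin 2 → ℝ)).measurableEmbedding.comp
    (MeasurableEquiv.finTwoArrow (α := ℝ)).symm.measurableEmbedding
  have hi := (hmp.integrable_comp_emb hemb).2 hG
  have he := hmp.integral_comp hemb G
  rw [← he]
  exact integral_prod_symm _ hi

/-! ### A smooth step and the scale of the transition region -/

lemma exists_smooth_step : ∃ (S dS ddS : ℝ → ℝ) (M : ℝ), 0 ≤ M ∧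
    (∀ u, HasDerivAt S (dS u) u) ∧ (∀ u, HasDerivAt dS (ddS u) u) ∧ Continuous ddS ∧
    (∀ u, |S u| ≤ 1) ∧ (∀ u, |dS u| ≤ M) ∧ (∀ u, |ddS u| ≤ M) ∧
    (∀ u < -1, S u = 0) ∧ (∀ u > 1, S u = 1) ∧
    (∀ u, 1 < |u| → dS u = 0) ∧ (∀ u, 1 < |u| → ddS u = 0) := by
  set S : ℝ → ℝ := fun u => Real.smoothTransition ((u + 1) / 2)
  have hsm : ContDiff ℝ 2 S := by
    have := Real.smoothTransition.contDiff (n := 2)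
    exact this.comp (by fun_prop)
  have hsm1 : ContDiff ℝ 1 (deriv S) := ContDiff.deriv' hsm
  have hsm2 : Continuous (deriv (deriv S)) := hsm1.continuous_deriv le_rfl
  have hlo : ∀ u < -1, S u = 0 := fun u hu =>
    Real.smoothTransition.zero_of_nonpos (by linarith)
  have hhi : ∀ u > 1, S u = 1 := fun u hu =>
    Real.smoothTransition.one_of_one_le (by linarith)
  have h1 : ∀ u, 1 < |u| → deriv S u = 0 := by
    intro u hu
    rcases lt_abs.1 hu with h | h
    · have : S =ᶠ[nhds u] fun _ => 1 := by
        filter_upwards [Ioi_mem_nhds h] with v hv using hhi v hv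
      rw [this.deriv_eq, deriv_const]
    · have : S =ᶠ[nhds u] fun _ => 0 := by
        filter_upwards [Iio_mem_nhds (lt_neg_of_lt_neg h)] with v hv using hlo v hv
      rw [this.deriv_eq, deriv_const]
  have h2 : ∀ u, 1 < |u| → deriv (deriv S) u = 0 := by
    intro u hu
    have : deriv S =ᶠ[nhds u] fun _ => 0 := by
      filter_upwards [(isOpen_lt continuous_const continuous_abs).mem_nhds hu] with v hv
        using h1 v hv
    rw [this.deriv_eq, deriv_const]
  have hbd : ∀ f : ℝ → ℝ, Continuous f → (∀ u, 1 < |u| → f u = 0) →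
      ∃ M, 0 ≤ M ∧ ∀ u, |f u| ≤ M := by
    intro f hf h0
    obtain ⟨M, hM⟩ := (isCompact_Icc (a := (-1 : ℝ)) (b := 1)).exists_bound_of_continuousOn
      hf.continuousOn
    refine ⟨max M 0, le_max_right _ _, fun u => ?_⟩
    by_cases hu : 1 < |u|
    · simp [h0 u hu]
    · exact (hM u (abs_le.1 (not_lt.1 hu))).trans (le_max_left _ _)
  obtain ⟨M₁, hM₁, hb₁⟩ := hbd _ hsm1.continuous h1
  obtain ⟨M₂, hM₂, hb₂⟩ := hbd _ hsm2 h2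
  refine ⟨S, deriv S, deriv (deriv S), max M₁ M₂, le_max_of_le_left hM₁,
    fun u => (hsm.differentiable two_ne_zero u).hasDerivAt,
    fun u => (hsm1.differentiable one_ne_zero u).hasDerivAt, hsm2, fun u => ?_,
    fun u => (hb₁ u).trans (le_max_left _ _), fun u => (hb₂ u).trans (le_max_right _ _),
    hlo, hhi, h1, h2⟩
  rw [abs_of_nonneg (Real.smoothTransition.nonneg _)]
  exact Real.smoothTransition.le_one _

/-- The inverse of the Japanese bracket, `(1 + y ^ 2) ^ (-1 / 2)`. -/
def invJap (y : ℝ) : ℝ := (√(1 + y ^ 2))⁻¹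

lemma invJap_pos (y : ℝ) : 0 < invJap y := by unfold invJap; positivity

lemma invJap_sq (y : ℝ) : (1 + y ^ 2) * invJap y ^ 2 = 1 := by
  have : (0 : ℝ) < 1 + y ^ 2 := by positivity
  rw [invJap, inv_pow, Real.sq_sqrt this.le, mul_inv_cancel₀ this.ne']

lemma invJap_le_one (y : ℝ) : invJap y ≤ 1 := by
  have := invJap_sq y
  have := invJap_pos y
  nlinarith [mul_nonneg (sq_nonneg y) (sq_nonneg (invJap y))]

lemma abs_mul_invJap_le_one (y : ℝ) : |y| * invJap y ≤ 1 := by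
  have h := invJap_sq y
  refine abs_le_of_sq_le_sq' ?_ zero_le_one |>.2
  rw [mul_pow, sq_abs]
  nlinarith [sq_nonneg (invJap y)]

lemma hasDerivAt_invJap (y : ℝ) : HasDerivAt invJap (-(y * invJap y ^ 3)) y := by
  have h0 : (0 : ℝ) < 1 + y ^ 2 := by positivity
  have h1 : HasDerivAt (fun y : ℝ => 1 + y ^ 2) (2 * y) y := by
    simpa using (hasDerivAt_pow 2 y).const_add 1
  refine ((h1.sqrt h0.ne').inv (Real.sqrt_ne_zero'.2 h0)).congr_deriv ?_
  have := (Real.sqrt_pos.2 h0).ne'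
  rw [invJap]
  field_simp

lemma hasDerivAt_invJap_deriv (y : ℝ) : HasDerivAt (fun y => -(y * invJap y ^ 3))
    (-(invJap y ^ 3) + 3 * y ^ 2 * invJap y ^ 5) y := by
  refine ((hasDerivAt_id y).mul ((hasDerivAt_invJap y).pow 3)).neg.congr_deriv ?_
  simp; ring

lemma continuous_invJap : Continuous invJap :=
  continuous_iff_continuousAt.2 fun y => (hasDerivAt_invJap y).continuousAt

lemma abs_le_one_add_of_abs_mul_invJap_le {x y : ℝ} (h : |x * invJap y| ≤ 1) : |x| ≤ 1 + |y| := by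
  rw [abs_mul, abs_of_pos (invJap_pos y)] at h
  have h1 := invJap_sq y
  have h2 : |x| ^ 2 ≤ 1 + y ^ 2 := by
    have hp : (|x| * invJap y) ^ 2 ≤ 1 := pow_le_one₀ (by have := invJap_pos y; positivity) h
    have hq : 0 < invJap y ^ 2 := pow_pos (invJap_pos y) 2
    refine le_of_mul_le_mul_right (a := invJap y ^ 2) ?_ hq
    rw [h1]; linarith [mul_pow |x| (invJap y) 2]
  refine abs_le_of_sq_le_sq' ?_ (by positivity) |>.2
  nlinarith [abs_nonneg y, sq_abs y]

lemma rpow_le_weight_rpow {z : E2} {s : ℝ} (hs : 1 < s) (h : |z 0 * invJap (z 1)| ≤ 1) :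
    (1 + |z 1|) ^ (1 - s) ≤ 2 ^ (s - 1) * weight z ^ (1 - s) := by
  have h1 : weight z / 2 ≤ 1 + |z 1| := by
    have := abs_le_one_add_of_abs_mul_invJap_le h
    have := abs_nonneg (z 1)
    unfold weight; linarith
  have hw := one_le_weight z
  calc (1 + |z 1|) ^ (1 - s) ≤ (weight z / 2) ^ (1 - s) :=
        Real.rpow_le_rpow_of_nonpos (by linarith) h1 (by linarith)
    _ = _ := by
        rw [Real.div_rpow (by linarith) (by norm_num), show s - 1 = -(1 - s) by ring,
          Real.rpow_neg (by norm_num : (0 : ℝ) ≤ 2)]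
        field_simp

lemma invJap_mul_rpow_le (y s : ℝ) :
    invJap y * (1 + |y|) ^ (2 - s) ≤ 2 * (1 + |y|) ^ (1 - s) := by
  have h : (1 + |y|) ^ (2 - s) = (1 + |y|) * (1 + |y|) ^ (1 - s) := by
    rw [show 2 - s = 1 + (1 - s) by ring, Real.rpow_add (by positivity), Real.rpow_one]
  have h1 := abs_mul_invJap_le_one y
  have h2 := invJap_le_one y
  have h3 : 0 ≤ (1 + |y|) ^ (1 - s) := by positivity
  rw [h, ← mul_assoc]
  refine mul_le_mul_of_nonneg_right ?_ h3
  linarith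

lemma abs_lineInt_sub_le {G : E2 → ℝ} {K s : ℝ} (hs : 1 < s) (hG : Continuous G)
    (hb : ∀ z, |G z| ≤ K * weight z ^ (-s)) {S : ℝ → ℝ} (hS : ∀ u, |S u| ≤ 1)
    (hlo : ∀ u < -1, S u = 0) (hhi : ∀ u > 1, S u = 1) (z : E2) :
    |lineInt (Iic 0) G z - S (z 0 * invJap (z 1)) * lineInt univ G z| ≤
      4 * K * 2 ^ (s - 1) / (s - 1) * weight z ^ (1 - s) := by
  have hK := nonneg_of_decay hb
  have hc := continuous_horiz hG (z 1)
  have hd := abs_horiz_le hb (z 1)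
  have h1 : 1 ≤ 1 + |z 1| := by simp
  have hs1 : 0 < s - 1 := by linarith
  have hq := invJap_pos (z 1)
  have hw : 0 ≤ weight z ^ (1 - s) := Real.rpow_nonneg (by linarith [one_le_weight z]) _
  have hweight : 1 + |z 1| + |z 0| = weight z := by unfold weight; ring
  have h2 : (1 : ℝ) ≤ 2 ^ (s - 1) := Real.one_le_rpow (by norm_num) hs1.le
  have hfar : K * weight z ^ (1 - s) / (s - 1) ≤
      4 * K * 2 ^ (s - 1) / (s - 1) * weight z ^ (1 - s) := by
    rw [mul_div_right_comm]
    refine mul_le_mul_of_nonneg_right ?_ hw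
    gcongr
    nlinarith
  rw [lineInt_Iic, lineInt_univ]
  by_cases hu : |z 0 * invJap (z 1)| ≤ 1
  · have hP := abs_setIntegral_le_of_decay hs h1 hc hd (Iic (z 0))
    have hh := abs_setIntegral_le_of_decay hs h1 hc hd univ
    rw [setIntegral_univ] at hh
    have hr := rpow_le_weight_rpow hs hu
    calc _ ≤ |∫ t in Iic (z 0), horiz G (z 1) t| +
          |S (z 0 * invJap (z 1)) * ∫ t, horiz G (z 1) t| := abs_sub _ _
      _ ≤ 2 * K * (1 + |z 1|) ^ (1 - s) / (s - 1) +
          1 * (2 * K * (1 + |z 1|) ^ (1 - s) / (s - 1)) := by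
        rw [abs_mul]
        gcongr
        exact hS _
      _ = 4 * K / (s - 1) * (1 + |z 1|) ^ (1 - s) := by ring
      _ ≤ 4 * K / (s - 1) * (2 ^ (s - 1) * weight z ^ (1 - s)) := by gcongr
      _ = _ := by ring
  · rcases lt_abs.1 (not_le.1 hu) with h | h
    · have hx : 0 ≤ z 0 := by
        by_contra hx
        nlinarith
      have hi := integrable_horiz hs hG hb (z 1)
      have := intervalIntegral.integral_Iic_add_Ioi (b := z 0) hi.integrableOn hi.integrableOn
      rw [hhi _ h, one_mul, ← this, sub_add_cancel_left, abs_neg]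
      have := abs_integral_Ioi_le_of_decay hs h1 hc hd hx
      rw [hweight] at this
      exact this.trans hfar
    · have hx : z 0 ≤ 0 := by
        by_contra hx
        nlinarith
      rw [hlo _ (lt_neg_of_lt_neg h), zero_mul, sub_zero]
      have := abs_integral_Iic_le_of_decay hs h1 hc hd hx
      rw [hweight] at this
      exact this.trans hfar

lemma abs_cutoff_mul_le {s N L φ v : ℝ} {z : E2} (hs : 1 < s) (hN : 0 ≤ N) (hL : 0 ≤ L)
    (h0 : 1 < |z 0 * invJap (z 1)| → φ = 0)
    (hφ : |z 0 * invJap (z 1)| ≤ 1 → |φ| ≤ N * invJap (z 1))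
    (hv : |v| ≤ L * (1 + |z 1|) ^ (2 - s)) :
    |φ * v| ≤ 2 * N * L * 2 ^ (s - 1) * weight z ^ (1 - s) := by
  have hw : 0 ≤ weight z ^ (1 - s) := Real.rpow_nonneg (by linarith [one_le_weight z]) _
  by_cases hu : |z 0 * invJap (z 1)| ≤ 1
  · have hq := invJap_pos (z 1)
    have h1 := invJap_mul_rpow_le (z 1) s
    have h2 := rpow_le_weight_rpow hs hu
    calc |φ * v| ≤ (N * invJap (z 1)) * (L * (1 + |z 1|) ^ (2 - s)) := by
          rw [abs_mul]
          exact mul_le_mul (hφ hu) hv (abs_nonneg _) (by positivity)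
      _ = N * L * (invJap (z 1) * (1 + |z 1|) ^ (2 - s)) := by ring
      _ ≤ N * L * (2 * (2 ^ (s - 1) * weight z ^ (1 - s))) :=
          mul_le_mul_of_nonneg_left (by linarith) (by positivity)
      _ = _ := by ring
  · rw [h0 (not_le.1 hu), zero_mul, abs_zero]
    positivity

/-! ### Construction of the potential -/

lemma exists_decaying_potential {B Bx By : E2 → ℝ} {K s : ℝ} (hs : 2 < s) (h : HasGrad B Bx By)
    (hcx : Continuous Bx) (hcy : Continuous By) (hB : ∀ z, |B z| ≤ K * weight z ^ (-s))
    (hBx : ∀ z, |Bx z| ≤ K * weight z ^ (-s)) (hBy : ∀ z, |By z| ≤ K * weight z ^ (-s))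
    (hflux : ∫ z, B z = 0) :
    ∃ (A₀ A₁ a₀₀ a₀₁ a₁₀ a₁₁ : E2 → ℝ) (C : ℝ), HasGrad A₀ a₀₀ a₀₁ ∧ HasGrad A₁ a₁₀ a₁₁ ∧
      Continuous a₀₀ ∧ Continuous a₀₁ ∧ Continuous a₁₀ ∧ Continuous a₁₁ ∧
      (∀ z, a₁₀ z - a₀₁ z = B z) ∧ (∀ z, |a₀₀ z + a₁₁ z| ≤ C * weight z ^ (1 - s)) ∧
      (∀ z, |A₀ z| + |A₁ z| ≤ C * weight z ^ (1 - s)) := by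
  have hs1 : 1 < s := by linarith
  have hK := nonneg_of_decay hB
  have hcB := h.continuous
  obtain ⟨S, dS, ddS, M, hM, hS, hdS, hcddS, hSb, hdS_le, hddS_le, hlo, hhi, hdS_zero, hddS_zero⟩ :=
    exists_smooth_step
  have hcS : Continuous S := continuous_iff_continuousAt.2 fun u => (hS u).continuousAt
  have hcdS : Continuous dS := continuous_iff_continuousAt.2 fun u => (hdS u).continuousAt
  have hcq := continuous_invJap
  -- the partial integral of `B` and its full integral over horizontal lines
  have hP : HasGrad (lineInt (Iic 0) B) B (lineInt (Iic 0) By) :=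
    (h.lineInt hs1 hcx hcy hB hBx hBy _).congr_grad (h.lineInt_Iic_eq hs1 hcx hB hBx)
      fun _ => rfl
  have hh : HasGrad (lineInt univ B) (fun _ => 0) (lineInt univ By) :=
    (h.lineInt hs1 hcx hcy hB hBx hBy _).congr_grad (h.lineInt_univ_eq_zero hs1 hcx hB hBx)
      fun _ => rfl
  have hch := hh.continuous
  have hcPy : Continuous (lineInt (Iic 0) By) := continuous_lineInt hs1 hcy hBy _
  have hchy : Continuous (lineInt univ By) := continuous_lineInt hs1 hcy hBy _
  -- the primitive of the full line integral
  set f : ℝ → ℝ := fun y => ∫ t, horiz B y t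
  have hhf : ∀ z, lineInt univ B z = f (z 1) := lineInt_univ B
  have hcf : Continuous f := by
    have : f = fun y => lineInt univ B !₂[0, y] := by
      funext y; simp [hhf]
    rw [this]
    exact hh.continuous.comp (by fun_prop)
  have hL : 0 ≤ 2 * K / (s - 1) := by
    have : 0 < s - 1 := by linarith
    positivity
  have hfb : ∀ y, |f y| ≤ 2 * K / (s - 1) * (1 + |y|) ^ (-(s - 1)) := fun y => by
    have := abs_lineInt_univ_le hs1 hcB hB !₂[0, y]
    rw [hhf] at this
    simpa using this
  have hfi : Integrable f := integrable_of_decay (by linarith) le_rfl hcf hfb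
  have hf0 : ∫ y, f y = 0 := by
    rw [← hflux, integral_eq_integral_horiz (integrable_of_weight_decay hs hcB hB)]
  set H : E2 → ℝ := fun z => ∫ t in Iic (z 1), f t
  have hHg : HasGrad H (fun _ => 0) (lineInt univ B) :=
    (HasGrad.comp (hasDerivAt_integral_Iic hcf hfi) hasGrad_coord_one).congr_grad
      (fun z => by simp) (fun z => by simp [hhf])
  have hcH := hHg.continuous
  set L : ℝ := 2 * K / (s - 1)
  set L' : ℝ := L / (s - 2)
  have hL' : 0 ≤ L' := by
    have : 0 < s - 2 := by linarith
    positivity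
  have hHb : ∀ z, |H z| ≤ L' * (1 + |z 1|) ^ (2 - s) := fun z => by
    have := abs_integral_Iic_le_of_decay_of_integral_eq_zero (by linarith) le_rfl hcf hfb hf0 (z 1)
    refine this.trans_eq ?_
    rw [show 1 - (s - 1) = 2 - s by ring, show s - 1 - 1 = s - 2 by ring]; ring
  have hhb : ∀ z, |lineInt univ B z| ≤ L * (1 + |z 1|) ^ (2 - s) := fun z => by
    refine (abs_lineInt_univ_le hs1 hcB hB z).trans (mul_le_mul_of_nonneg_left ?_ hL)
    exact Real.rpow_le_rpow_of_exponent_le (by simp) (by linarith)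
  -- the step function at scale `1 + |y|`
  have hq : HasGrad (fun z => invJap (z 1)) (fun _ => 0) (fun z => -(z 1 * invJap (z 1) ^ 3)) :=
    (HasGrad.comp hasDerivAt_invJap hasGrad_coord_one).congr_grad (fun z => by simp)
      (fun z => by simp)
  have hq' : HasGrad (fun z => -(z 1 * invJap (z 1) ^ 3)) (fun _ => 0)
      (fun z => -(invJap (z 1) ^ 3) + 3 * z 1 ^ 2 * invJap (z 1) ^ 5) :=
    (HasGrad.comp hasDerivAt_invJap_deriv hasGrad_coord_one).congr_grad (fun z => by simp)
      (fun z => by simp)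
  have hu : HasGrad (fun z => z 0 * invJap (z 1)) (fun z => invJap (z 1))
      (fun z => z 0 * -(z 1 * invJap (z 1) ^ 3)) :=
    (hasGrad_coord_zero.mul hq).congr_grad (fun z => by simp) (fun z => by simp)
  have hR := HasGrad.comp hS hu
  have hRx := (HasGrad.comp hdS hu).mul hq
  have hRy := (HasGrad.comp hdS hu).mul (hasGrad_coord_zero.mul hq')
  have hA₀ := (hRx.mul hHg).neg
  have hA₁ := (hP.sub (hRy.mul hHg)).sub (hR.mul hh)
  -- bounds on the transition region
  have hyq : ∀ z : E2, |z 0 * invJap (z 1)| ≤ 1 →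
      |z 0 * -(z 1 * invJap (z 1) ^ 3)| ≤ invJap (z 1) := fun z hz => by
    have h1 := abs_mul_invJap_le_one (z 1)
    have hq := invJap_pos (z 1)
    have : |z 0 * -(z 1 * invJap (z 1) ^ 3)| =
        |z 0 * invJap (z 1)| * (|z 1| * invJap (z 1)) * invJap (z 1) := by
      simp only [abs_mul, abs_neg, abs_pow, abs_of_pos hq]; ring
    rw [this]
    exact mul_le_of_le_one_left hq.le (mul_le_one₀ hz (by positivity) h1)
  have hRxb : ∀ z, |dS (z 0 * invJap (z 1)) * invJap (z 1) * H z| ≤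
      2 * M * L' * 2 ^ (s - 1) * weight z ^ (1 - s) := fun z =>
    abs_cutoff_mul_le hs1 hM hL' (fun hz => by rw [hdS_zero _ hz, zero_mul])
      (fun _ => by
        rw [abs_mul, abs_of_pos (invJap_pos _)]
        exact mul_le_mul_of_nonneg_right (hdS_le _) (invJap_pos _).le) (hHb z)
  have hRyφ : ∀ z : E2, |z 0 * invJap (z 1)| ≤ 1 →
      |dS (z 0 * invJap (z 1)) * (z 0 * -(z 1 * invJap (z 1) ^ 3))| ≤ M * invJap (z 1) :=
    fun z hz => by
      rw [abs_mul]
      exact mul_le_mul (hdS_le _) (hyq z hz) (abs_nonneg _) hM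
  have hRyb : ∀ z, |dS (z 0 * invJap (z 1)) * (z 0 * -(z 1 * invJap (z 1) ^ 3)) * H z| ≤
      2 * M * L' * 2 ^ (s - 1) * weight z ^ (1 - s) := fun z =>
    abs_cutoff_mul_le hs1 hM hL' (fun hz => by rw [hdS_zero _ hz, zero_mul]) (hRyφ z) (hHb z)
  have hRyhb : ∀ z, |dS (z 0 * invJap (z 1)) * (z 0 * -(z 1 * invJap (z 1) ^ 3)) *
      lineInt univ B z| ≤ 2 * M * L * 2 ^ (s - 1) * weight z ^ (1 - s) := fun z =>
    abs_cutoff_mul_le hs1 hM hL (fun hz => by rw [hdS_zero _ hz, zero_mul]) (hRyφ z) (hhb z)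
  have hLapb : ∀ z, |(ddS (z 0 * invJap (z 1)) * (invJap (z 1) * invJap (z 1) +
        (z 0 * -(z 1 * invJap (z 1) ^ 3)) * (z 0 * -(z 1 * invJap (z 1) ^ 3))) +
      dS (z 0 * invJap (z 1)) *
        (z 0 * (-(invJap (z 1) ^ 3) + 3 * z 1 ^ 2 * invJap (z 1) ^ 5))) * H z| ≤
      2 * (6 * M) * L' * 2 ^ (s - 1) * weight z ^ (1 - s) := fun z =>
    abs_cutoff_mul_le hs1 (by positivity) hL'
      (fun hz => by rw [hdS_zero _ hz, hddS_zero _ hz, zero_mul, zero_mul, add_zero])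
      (fun hz => by
        have hq0 := invJap_pos (z 1)
        have hq1 := invJap_le_one (z 1)
        have hqq : invJap (z 1) * invJap (z 1) ≤ invJap (z 1) := mul_le_of_le_one_left hq0.le hq1
        have hy2 : z 1 ^ 2 * invJap (z 1) ^ 2 ≤ 1 := by nlinarith [invJap_sq (z 1)]
        have h1 : |invJap (z 1) * invJap (z 1) +
            (z 0 * -(z 1 * invJap (z 1) ^ 3)) * (z 0 * -(z 1 * invJap (z 1) ^ 3))| ≤
            2 * invJap (z 1) := by
          refine (abs_add_le _ _).trans ?_
          have h2 := mul_le_mul (hyq z hz) (hyq z hz) (abs_nonneg _) hq0.le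
          rw [← abs_mul] at h2
          rw [abs_of_pos (mul_pos hq0 hq0)]
          linarith
        have h3 : |z 0 * (-(invJap (z 1) ^ 3) + 3 * z 1 ^ 2 * invJap (z 1) ^ 5)| ≤
            4 * invJap (z 1) := by
          have : z 0 * (-(invJap (z 1) ^ 3) + 3 * z 1 ^ 2 * invJap (z 1) ^ 5) =
              (z 0 * invJap (z 1)) * (invJap (z 1) * invJap (z 1)) *
                (-1 + 3 * (z 1 ^ 2 * invJap (z 1) ^ 2)) := by ring
          rw [this, abs_mul, abs_mul, abs_of_pos (mul_pos hq0 hq0)]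
          have h4 : |-1 + 3 * (z 1 ^ 2 * invJap (z 1) ^ 2)| ≤ 4 := by
            rw [abs_le]
            constructor <;> nlinarith [sq_nonneg (z 1 * invJap (z 1))]
          have h5 : |z 0 * invJap (z 1)| * (invJap (z 1) * invJap (z 1)) ≤ invJap (z 1) :=
            (mul_le_of_le_one_left (by positivity) hz).trans hqq
          have := mul_le_mul h5 h4 (abs_nonneg _) hq0.le
          linarith
        refine (abs_add_le _ _).trans ?_
        rw [abs_mul, abs_mul]
        have h6 := mul_le_mul (hddS_le (z 0 * invJap (z 1))) h1 (abs_nonneg _) hM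
        have h7 := mul_le_mul (hdS_le (z 0 * invJap (z 1))) h3 (abs_nonneg _) hM
        linarith)
      (hHb z)
  set C₁ : ℝ := 4 * K * 2 ^ (s - 1) / (s - 1)
  have hPb := abs_lineInt_sub_le hs1 hcB hB hSb hlo hhi
  have hPyb := abs_lineInt_sub_le hs1 hcy hBy hSb hlo hhi
  have hw : ∀ z, 0 ≤ weight z ^ (1 - s) := fun z =>
    Real.rpow_nonneg (by linarith [one_le_weight z]) _
  have hC₁ : 0 ≤ C₁ := by
    have : 0 < s - 1 := by linarith
    positivity
  refine ⟨_, _, _, _, _, _, C₁ + 2 * (2 * M * L' * 2 ^ (s - 1)) + 2 * (2 * M * L * 2 ^ (s - 1)) +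
    2 * (6 * M) * L' * 2 ^ (s - 1), hA₀, hA₁, ?_, ?_, ?_, ?_, ?_, ?_, ?_⟩
  · fun_prop
  · fun_prop
  · fun_prop
  · fun_prop
  · intro z; ring
  · intro z
    have h1 := abs_le.1 (hPyb z)
    have h2 := abs_le.1 (hLapb z)
    have h3 := abs_le.1 (hRyhb z)
    have h4 : 0 ≤ 2 * M * L' * 2 ^ (s - 1) * weight z ^ (1 - s) :=
      mul_nonneg (by positivity) (hw z)
    rw [abs_le]
    constructor <;> linarith
  · intro z
    have h1 := hPb z
    have h2 := hRxb z
    have h3 := hRyb z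
    have h4 : 0 ≤ 2 * M * L * 2 ^ (s - 1) * weight z ^ (1 - s) :=
      mul_nonneg (by positivity) (hw z)
    have h5 : 0 ≤ 2 * (6 * M) * L' * 2 ^ (s - 1) * weight z ^ (1 - s) :=
      mul_nonneg (by positivity) (hw z)
    have h6 := abs_sub (lineInt (Iic 0) B z - S (z 0 * invJap (z 1)) * lineInt univ B z)
      (dS (z 0 * invJap (z 1)) * (z 0 * -(z 1 * invJap (z 1) ^ 3)) * H z)
    rw [abs_neg, sub_right_comm]
    linarith

lemma weight_le (z : E2) : weight z ≤ 2 * (1 + ‖z‖) := by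
  have h0 := PiLp.norm_apply_le z 0
  have h1 := PiLp.norm_apply_le z 1
  rw [Real.norm_eq_abs] at h0 h1
  unfold weight; linarith

lemma tendsto_cube_mul_of_decay {f : E2 → ℝ} {C s : ℝ} (hs : 4 < s)
    (hf : ∀ z, |f z| ≤ C * weight z ^ (1 - s)) :
    Tendsto (fun z => (1 + ‖z‖) ^ 3 * f z) (cocompact E2) (nhds 0) := by
  have hC : 0 ≤ C := by
    have := (abs_nonneg _).trans (hf 0)
    simpa [weight] using this
  have h1 : Tendsto (fun z : E2 => 1 + ‖z‖) (cocompact E2) atTop :=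
    tendsto_atTop_add_const_left _ _ tendsto_norm_cocompact_atTop
  have h2 := ((tendsto_rpow_neg_atTop (by linarith : 0 < s - 4)).comp h1).const_mul C
  rw [mul_zero] at h2
  refine squeeze_zero_norm (fun z => ?_) h2
  have hz : 0 < 1 + ‖z‖ := by positivity
  rw [Real.norm_eq_abs, abs_mul, abs_of_pos (pow_pos hz 3)]
  calc (1 + ‖z‖) ^ 3 * |f z| ≤ (1 + ‖z‖) ^ 3 * (C * (1 + ‖z‖) ^ (1 - s)) := by
        refine mul_le_mul_of_nonneg_left ((hf z).trans (mul_le_mul_of_nonneg_left ?_ hC))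
          (by positivity)
        exact Real.rpow_le_rpow_of_nonpos hz (one_add_norm_le_weight z) (by linarith)
    _ = C * ((1 + ‖z‖) ^ (3 : ℝ) * (1 + ‖z‖) ^ (1 - s)) := by
        rw [← Real.rpow_natCast]; push_cast; ring
    _ = C * (1 + ‖z‖) ^ (-(s - 4)) := by
        rw [← Real.rpow_add hz]; congr 2; ring

lemma abs_le_weight_rpow_of_decay {F : E2 → ℝ} {C r s : ℝ} (hs : 0 ≤ s) (hr : r ≤ -s) (hC : 0 < C)
    (h : ∀ z, |F z| ≤ C * (1 + ‖z‖) ^ r) : ∀ z, |F z| ≤ C * 2 ^ s * weight z ^ (-s) := by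
  intro z
  have hw := one_le_weight z
  calc |F z| ≤ C * (1 + ‖z‖) ^ r := h z
    _ ≤ C * (1 + ‖z‖) ^ (-s) := by
        gcongr; simp
    _ ≤ C * (weight z / 2) ^ (-s) := by
        refine mul_le_mul_of_nonneg_left ?_ hC.le
        exact Real.rpow_le_rpow_of_nonpos (by linarith) (by linarith [weight_le z]) (by linarith)
    _ = _ := by
        rw [Real.div_rpow (by linarith) (by norm_num), Real.rpow_neg (by norm_num : (0 : ℝ) ≤ 2)]
        field_simp

theorem stmt1 (B : E2 → ℝ) (hB : ContDiff ℝ (⊤ : ℕ∞) B)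
    (hdecay : ∃ s : ℝ, 4 < s ∧ ∀ β : ℕ × ℕ, ∃ C : ℝ, 0 < C ∧ ∀ x : E2,
      |pdMulti β B x| ≤ C * (1 + ‖x‖) ^ (-s - ((β.1 : ℝ) + (β.2 : ℝ))))
    (hflux : (∫ x : E2, B x) = 0) :
    ∃ A : E2 → E2, ContDiff ℝ 1 A ∧
      (∀ x : E2, pd 0 (fun y => A y 1) x - pd 1 (fun y => A y 0) x = B x) ∧
      Tendsto (fun x : E2 => (1 + ‖x‖) ^ 3 *
          (pd 0 (fun y => A y 0) x + pd 1 (fun y => A y 1) x))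
        (cocompact E2) (nhds 0) ∧
      Tendsto (fun x : E2 => (1 + ‖x‖) ^ 3 * ‖A x‖)
        (cocompact E2) (nhds 0) := by
  obtain ⟨s, hs, hd⟩ := hdecay
  obtain ⟨C₀, hC₀, h₀⟩ := hd (0, 0)
  obtain ⟨C₁, hC₁, h₁⟩ := hd (1, 0)
  obtain ⟨C₂, hC₂, h₂⟩ := hd (0, 1)
  have hs0 : 0 ≤ s := by linarith
  have d₀ := abs_le_weight_rpow_of_decay hs0 (by simp) hC₀ h₀
  have d₁ := abs_le_weight_rpow_of_decay hs0 (by simp) hC₁ h₁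
  have d₂ := abs_le_weight_rpow_of_decay hs0 (by simp) hC₂ h₂
  have hB1 : ContDiff ℝ 1 B := hB.of_le (by exact_mod_cast le_top)
  have hc : ∀ i, Continuous (pd i B) := fun i =>
    (hB1.continuous_fderiv one_ne_zero).clm_apply continuous_const
  have hle : ∀ {C : ℝ} (z : E2), C ≤ C₀ + C₁ + C₂ →
      C * 2 ^ s * weight z ^ (-s) ≤ (C₀ + C₁ + C₂) * 2 ^ s * weight z ^ (-s) := by
    intro C z hC
    have : 0 ≤ weight z ^ (-s) := Real.rpow_nonneg (by linarith [one_le_weight z]) _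
    gcongr
  obtain ⟨A₀, A₁, a₀₀, a₀₁, a₁₀, a₁₁, C, hA₀, hA₁, c₀₀, c₀₁, c₁₀, c₁₁, hcurl, hdiv, hbd⟩ :=
    exists_decaying_potential (by linarith) (HasGrad.of_contDiff hB1) (hc 0) (hc 1)
      (fun z => (d₀ z).trans (hle z (by linarith))) (fun z => (d₁ z).trans (hle z (by linarith)))
      (fun z => (d₂ z).trans (hle z (by linarith))) hflux
  refine ⟨fun z => !₂[A₀ z, A₁ z], ?_, ?_, ?_, ?_⟩
  · refine contDiff_euclidean.2 fun i => ?_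
    fin_cases i
    · exact hA₀.contDiff_one c₀₀ c₀₁
    · exact hA₁.contDiff_one c₁₀ c₁₁
  · intro z
    change pd 0 A₁ z - pd 1 A₀ z = B z
    rw [hA₁.pd_zero, hA₀.pd_one, hcurl]
  · change Tendsto (fun z : E2 => (1 + ‖z‖) ^ 3 * (pd 0 A₀ z + pd 1 A₁ z)) _ _
    simp only [hA₀.pd_zero, hA₁.pd_one]
    exact tendsto_cube_mul_of_decay hs hdiv
  · refine tendsto_cube_mul_of_decay hs fun z => le_trans ?_ (hbd z)
    rw [abs_norm, EuclideanSpace.norm_eq, Fin.sum_univ_two, Real.sqrt_le_left (by positivity)]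
    simp only [Real.norm_eq_abs]
    simp
    nlinarith [mul_nonneg (abs_nonneg (A₀ z)) (abs_nonneg (A₁ z)), sq_abs (A₀ z), sq_abs (A₁ z)]
end
end

section
/- Let 0 < ε < 1 and s > 3/2 + ε. There exists a constant C > 0, depending only on s and ε, such that for every ν ≥ 0 and every λ ∈ (0,1): ∫₁^∞ J_ν(√λ · r)² (1+r)^{-2s} r dr ≤ C (λ^ν + λ^{1/2+ε}) / (1+ν²). -/
open scoped Real

noncomputable section

/-- The Bessel function of the first kind `J_ν(z)`, defined by its power series;
`1/Γ` is interpreted as `0` at the poles of `Γ` (Mathlib's `Real.Gamma` vanishes there). -/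
noncomputable def besselJ (ν z : ℝ) : ℝ :=
  (z/2) ^ ν * ∑' k : ℕ, (-1:ℝ) ^ k * (z/2) ^ (2*k) / ((k.factorial : ℝ) * Real.Gamma (ν + k + 1))

/-- The coefficients of the entire function `x ↦ x ^ (-ν / 2) * J_ν (2 * √x)`. -/
def besselCoeff (ν : ℝ) (k : ℕ) : ℝ :=
  (-1) ^ k / ((k.factorial : ℝ) * Real.Gamma (ν + k + 1))

/-- The entire function `φ_ν` such that `J_ν z = (z / 2) ^ ν * φ_ν ((z / 2) ^ 2)`. -/
def besselEntire (ν x : ℝ) : ℝ := ∑' k : ℕ, besselCoeff ν k * x ^ k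

lemma besselJ_eq (ν z : ℝ) : besselJ ν z = (z / 2) ^ ν * besselEntire ν ((z / 2) ^ 2) := by
  simp only [besselJ, besselEntire, besselCoeff, pow_mul]
  congr 1
  exact tsum_congr fun k => by ring

lemma exists_pos_le_Gamma : ∃ c : ℝ, 0 < c ∧ ∀ x : ℝ, 0 < x → c ≤ Real.Gamma x := by
  obtain ⟨x, hx, hmin⟩ := Real.exists_isMinOn_Gamma_Ioi
  exact ⟨Real.Gamma x, Real.Gamma_pos_of_pos (by linarith [hx.1]), fun y hy => hmin hy⟩

lemma exists_abs_besselCoeff_le :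
    ∃ K : ℝ, 0 < K ∧ ∀ ν : ℝ, 0 ≤ ν → ∀ k : ℕ, |besselCoeff ν k| ≤ K / k.factorial := by
  obtain ⟨c, hc, h⟩ := exists_pos_le_Gamma
  refine ⟨c⁻¹, inv_pos.2 hc, fun ν hν k => ?_⟩
  have h1 := h (ν + k + 1) (by positivity)
  have h2 : 0 < Real.Gamma (ν + k + 1) := hc.trans_le h1
  have h3 : (0 : ℝ) < k.factorial := by positivity
  rw [besselCoeff, abs_div, abs_pow, abs_neg, abs_one, one_pow, abs_of_pos (by positivity),
    inv_eq_one_div, div_div]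
  rw [mul_comm c]
  gcongr

lemma besselCoeff_succ (ν : ℝ) (k : ℕ) :
    besselCoeff ν (k + 1) * (k + 1) = -besselCoeff (ν + 1) k := by
  have h : (k : ℝ) + 1 ≠ 0 := by positivity
  simp only [besselCoeff, Nat.factorial_succ, pow_succ]
  push_cast
  rw [show ν + (k + 1 : ℝ) + 1 = ν + 1 + k + 1 by ring, div_mul_eq_mul_div,
    show (-1 : ℝ) ^ k * -1 * (k + 1) = (k + 1) * (-(-1) ^ k) by ring, mul_assoc,
    mul_div_mul_left _ _ h, neg_div]

lemma besselCoeff_eq {ν : ℝ} (hν : 0 ≤ ν) (k : ℕ) :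
    besselCoeff ν k = (ν + 1) * besselCoeff (ν + 1) k + besselCoeff (ν + 1) k * k := by
  have h : ν + k + 1 ≠ 0 := by positivity
  have h2 : Real.Gamma (ν + k + 1) ≠ 0 := (Real.Gamma_pos_of_pos (by positivity)).ne'
  have h3 : (k.factorial : ℝ) ≠ 0 := by positivity
  simp only [besselCoeff]
  rw [show ν + 1 + (k : ℝ) + 1 = ν + k + 1 + 1 by ring, Real.Gamma_add_one h]
  field_simp
  ring

lemma summable_besselCoeff_mul_pow {ν : ℝ} (hν : 0 ≤ ν) (x : ℝ) :
    Summable fun k : ℕ => besselCoeff ν k * x ^ k := by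
  obtain ⟨K, -, hK⟩ := exists_abs_besselCoeff_le
  refine Summable.of_norm_bounded ((Real.summable_pow_div_factorial |x|).mul_left K) fun k => ?_
  rw [Real.norm_eq_abs, abs_mul, abs_pow]
  calc _ ≤ K / k.factorial * |x| ^ k := by gcongr; exact hK ν hν k
    _ = _ := by ring

lemma exists_abs_besselEntire_le :
    ∃ K : ℝ, 0 < K ∧ ∀ ν : ℝ, 0 ≤ ν → ∀ x : ℝ, |besselEntire ν x| ≤ K * Real.exp |x| := by
  obtain ⟨K, hK0, hK⟩ := exists_abs_besselCoeff_le
  refine ⟨K, hK0, fun ν hν x => ?_⟩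
  have h : HasSum (fun k : ℕ => K * (|x| ^ k / k.factorial)) (K * Real.exp |x|) := by
    refine HasSum.mul_left K ?_
    rw [Real.exp_eq_exp_ℝ]
    exact NormedSpace.expSeries_div_hasSum_exp |x|
  rw [← Real.norm_eq_abs]
  refine tsum_of_norm_bounded h fun k => ?_
  rw [Real.norm_eq_abs, abs_mul, abs_pow]
  calc _ ≤ K / k.factorial * |x| ^ k := by gcongr; exact hK ν hν k
    _ = _ := by ring

lemma hasDerivAt_besselEntire {ν : ℝ} (hν : 0 ≤ ν) (x : ℝ) :
    HasDerivAt (besselEntire ν) (-besselEntire (ν + 1) x) x := by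
  obtain ⟨K, hK0, hK⟩ := exists_abs_besselCoeff_le
  set R := |x| + 1 with hR
  have hR0 : 0 < R := by positivity
  have hu : Summable fun k : ℕ => |besselCoeff ν k| * (k * R ^ (k - 1)) := by
    rw [← summable_nat_add_iff 1]
    refine Summable.of_norm_bounded ((Real.summable_pow_div_factorial R).mul_left K) fun k => ?_
    have := hK (ν + 1) (by linarith) k
    rw [← abs_neg, ← besselCoeff_succ, abs_mul, abs_of_pos (by positivity : (0 : ℝ) < k + 1)]
      at this
    rw [Real.norm_eq_abs, abs_of_nonneg (by positivity)]
    push_cast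
    calc _ = |besselCoeff ν (k + 1)| * (k + 1) * R ^ k := by ring
      _ ≤ K / k.factorial * R ^ k := by gcongr
      _ = _ := by ring
  have key := hasDerivAt_tsum_of_isPreconnected (𝕜 := ℝ)
    (g := fun (k : ℕ) y => besselCoeff ν k * y ^ k)
    (g' := fun (k : ℕ) y => besselCoeff ν k * (k * y ^ (k - 1))) (t := Metric.ball 0 R)
    (y₀ := 0) (y := x) hu Metric.isOpen_ball (convex_ball _ _).isPreconnected
    (fun k y _ => (hasDerivAt_pow k y).const_mul _)
    (fun k y hy => by
      rw [mem_ball_zero_iff, Real.norm_eq_abs] at hy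
      rw [Real.norm_eq_abs, abs_mul, abs_mul, abs_pow, Nat.abs_cast]
      gcongr)
    (Metric.mem_ball_self hR0) (summable_besselCoeff_mul_pow hν 0) (by simp [hR])
  have hs : Summable fun k : ℕ => besselCoeff ν k * (k * x ^ (k - 1)) := by
    refine Summable.of_norm_bounded hu fun k => ?_
    rw [Real.norm_eq_abs, abs_mul, abs_mul, abs_pow, Nat.abs_cast]
    have : |x| ≤ R := by simp [hR]
    gcongr
  convert! key using 1
  rw [hs.tsum_eq_zero_add, besselEntire, ← tsum_neg]
  simp only [Nat.cast_zero, zero_mul, mul_zero, zero_add]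
  refine tsum_congr fun k => ?_
  have := besselCoeff_succ ν k
  push_cast
  linear_combination (-x ^ k) * this

lemma besselEntire_recurrence {ν : ℝ} (hν : 0 ≤ ν) (x : ℝ) :
    besselEntire ν x = (ν + 1) * besselEntire (ν + 1) x - x * besselEntire (ν + 2) x := by
  have h1 := summable_besselCoeff_mul_pow (by linarith : 0 ≤ ν + 1) x
  have h2 := summable_besselCoeff_mul_pow (by linarith : 0 ≤ ν + 2) x
  have hterm (k : ℕ) : besselCoeff (ν + 1) (k + 1) * ((k + 1 : ℕ) : ℝ) * x ^ (k + 1) =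
      -x * (besselCoeff (ν + 2) k * x ^ k) := by
    push_cast
    rw [besselCoeff_succ, show ν + 1 + 1 = ν + 2 by ring]
    ring
  have h3 : Summable fun k : ℕ => besselCoeff (ν + 1) k * k * x ^ k := by
    rw [← summable_nat_add_iff 1]
    simp only [hterm]
    exact h2.mul_left _
  have h4 : ∑' k : ℕ, besselCoeff (ν + 1) k * k * x ^ k = -x * besselEntire (ν + 2) x := by
    rw [h3.tsum_eq_zero_add]
    simp only [hterm]
    rw [tsum_mul_left, besselEntire]
    simp
  calc besselEntire ν x
      = ∑' k : ℕ, ((ν + 1) * (besselCoeff (ν + 1) k * x ^ k)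
          + besselCoeff (ν + 1) k * k * x ^ k) := by
        refine tsum_congr fun k => ?_
        rw [besselCoeff_eq hν k]
        ring
    _ = _ := by
        rw [(h1.mul_left _).tsum_add h3, h4, tsum_mul_left, ← besselEntire]
        ring

lemma hasDerivAt_besselJ {ν z : ℝ} (hν : 0 ≤ ν) (hz : 0 < z) :
    HasDerivAt (besselJ ν) (ν / z * besselJ ν z - besselJ (ν + 1) z) z := by
  have hz2 : 0 < z / 2 := by positivity
  have h0 : HasDerivAt (fun t : ℝ => t / 2) (1 / 2) z := (hasDerivAt_id z).div_const 2
  have h1 := h0.rpow_const (p := ν) (Or.inl hz2.ne')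
  have h2 := (hasDerivAt_besselEntire hν ((z / 2) ^ 2)).comp z (h0.pow 2)
  have h3 := h1.mul h2
  rw [show besselJ ν = _ from funext (besselJ_eq ν)]
  refine h3.congr_deriv ?_
  simp only [besselJ_eq, Real.rpow_add_one hz2.ne', Real.rpow_sub_one hz2.ne', Function.comp,
    Pi.pow_apply]
  field_simp
  ring

lemma besselJ_recurrence {ν z : ℝ} (hν : 0 ≤ ν) (hz : 0 < z) :
    besselJ ν z + besselJ (ν + 2) z = 2 * (ν + 1) / z * besselJ (ν + 1) z := by
  have hz2 : 0 < z / 2 := by positivity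
  simp only [besselJ_eq]
  rw [besselEntire_recurrence hν, Real.rpow_add_one hz2.ne', show ν + 2 = ν + 1 + 1 by ring,
    Real.rpow_add_one hz2.ne', Real.rpow_add_one hz2.ne']
  field_simp
  ring

lemma hasDerivAt_besselJ_succ {ν z : ℝ} (hν : 0 ≤ ν) (hz : 0 < z) :
    HasDerivAt (besselJ (ν + 1)) (besselJ ν z - (ν + 1) / z * besselJ (ν + 1) z) z := by
  refine (hasDerivAt_besselJ (by linarith : 0 ≤ ν + 1) hz).congr_deriv ?_
  have := besselJ_recurrence hν hz
  rw [show ν + 1 + 1 = ν + 2 by ring]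
  linear_combination -this

lemma continuousOn_besselJ {ν : ℝ} (hν : 0 ≤ ν) : ContinuousOn (besselJ ν) (Set.Ioi 0) :=
  fun _ hz => (hasDerivAt_besselJ hν hz).continuousAt.continuousWithinAt

lemma exists_sq_besselJ_le : ∃ K : ℝ, 0 < K ∧ ∀ ν z : ℝ, 0 ≤ ν → 0 ≤ z →
    besselJ ν z ^ 2 ≤ K * (z / 2) ^ (2 * ν) * Real.exp (z ^ 2) := by
  obtain ⟨K, hK0, hK⟩ := exists_abs_besselEntire_le
  refine ⟨K ^ 2, by positivity, fun ν z hν hz => ?_⟩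
  have h1 := hK ν hν ((z / 2) ^ 2)
  rw [abs_of_nonneg (by positivity : 0 ≤ (z / 2) ^ 2)] at h1
  rw [besselJ_eq, mul_pow, ← Real.rpow_mul_natCast (by positivity), Nat.cast_two, mul_comm ν 2,
    ← sq_abs (besselEntire _ _)]
  have h2 : Real.exp ((z / 2) ^ 2) ^ 2 ≤ Real.exp (z ^ 2) := by
    rw [← Real.exp_nat_mul, Real.exp_le_exp]
    push_cast
    nlinarith
  calc _ ≤ (z / 2) ^ (2 * ν) * (K * Real.exp ((z / 2) ^ 2)) ^ 2 := by gcongr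
    _ = K ^ 2 * (z / 2) ^ (2 * ν) * Real.exp ((z / 2) ^ 2) ^ 2 := by ring
    _ ≤ _ := by gcongr

/-- A modified energy of the system satisfied by `(√z * J_ν z, √z * J_{ν+1} z)`, whose derivative
is of lower order. -/
def besselEnergy (ν z : ℝ) : ℝ :=
  z * (besselJ ν z ^ 2 + besselJ (ν + 1) z ^ 2) - (2 * ν + 1) * (besselJ ν z * besselJ (ν + 1) z)

lemma hasDerivAt_besselEnergy {ν z : ℝ} (hν : 0 ≤ ν) (hz : 0 < z) :
    HasDerivAt (besselEnergy ν) ((2 * ν + 1) / z * (besselJ ν z * besselJ (ν + 1) z)) z := by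
  have h0 := hasDerivAt_besselJ hν hz
  have h1 := hasDerivAt_besselJ_succ hν hz
  refine (((hasDerivAt_id z).mul ((h0.pow 2).add (h1.pow 2))).sub
    ((h0.mul h1).const_mul (2 * ν + 1))).congr_deriv ?_
  simp only [id, Pi.add_apply, Pi.pow_apply]
  field_simp
  ring

lemma half_mul_le_besselEnergy {ν z : ℝ} (hν : 0 ≤ ν) (hz : 2 * ν + 1 ≤ z) :
    z / 2 * (besselJ ν z ^ 2 + besselJ (ν + 1) z ^ 2) ≤ besselEnergy ν z := by
  have h := sq_nonneg (besselJ ν z - besselJ (ν + 1) z)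
  have h' := sq_nonneg (besselJ ν z + besselJ (ν + 1) z)
  rw [besselEnergy]
  nlinarith [mul_nonneg (sub_nonneg.2 hz) (add_nonneg (sq_nonneg (besselJ ν z))
    (sq_nonneg (besselJ (ν + 1) z))), mul_nonneg (by linarith : 0 ≤ 2 * ν + 1) h]

lemma antitoneOn_besselEnergy_mul_exp {ν : ℝ} (hν : 0 ≤ ν) (hν2 : ν ≤ 2) :
    AntitoneOn (fun z => besselEnergy ν z * Real.exp (5 / z)) (Set.Ici 5) := by
  have hd (z : ℝ) (hz : 0 < z) := (hasDerivAt_besselEnergy hν hz).mul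
    (((hasDerivAt_inv hz.ne').const_mul 5).exp)
  simp only [div_eq_mul_inv (5 : ℝ)]
  refine antitoneOn_of_deriv_nonpos (convex_Ici 5)
    (fun z hz => (hd z (by linarith [Set.mem_Ici.1 hz])).continuousAt.continuousWithinAt)
    (fun z hz => ?_) (fun z hz => ?_)
  · rw [interior_Ici, Set.mem_Ioi] at hz
    exact (hd z (by linarith)).differentiableAt.differentiableWithinAt
  · rw [interior_Ici, Set.mem_Ioi] at hz
    have hz0 : 0 < z := by linarith
    have h1 := half_mul_le_besselEnergy hν (by linarith : 2 * ν + 1 ≤ z)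
    refine ((hd z hz0).deriv).trans_le ?_
    set A := besselJ ν z
    set B := besselJ (ν + 1) z
    have h2 : (2 * ν + 1) / z * (A * B) ≤ 5 / z ^ 2 * besselEnergy ν z := by
      have h3 : (2 * ν + 1) * (A * B) ≤ 5 * ((A ^ 2 + B ^ 2) / 2) := by
        nlinarith [sq_nonneg (A - B), sq_nonneg (A + B), sq_nonneg A, sq_nonneg B,
          mul_nonneg hν (sq_nonneg (A - B)), mul_nonneg (sub_nonneg.2 hν2) (sq_nonneg A),
          mul_nonneg (sub_nonneg.2 hν2) (sq_nonneg B)]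
      calc (2 * ν + 1) / z * (A * B) = ((2 * ν + 1) * (A * B)) / z := by ring
        _ ≤ (5 * ((A ^ 2 + B ^ 2) / 2)) / z := by gcongr
        _ = 5 / z ^ 2 * (z / 2 * (A ^ 2 + B ^ 2)) := by field_simp
        _ ≤ _ := by gcongr
    have h4 := mul_le_mul_of_nonneg_right h2 (Real.exp_pos (5 * z⁻¹)).le
    rw [show 5 / z ^ 2 = 5 * (z ^ 2)⁻¹ by ring] at h4
    linarith

lemma exists_sq_besselJ_le_div :
    ∃ C : ℝ, 0 < C ∧ ∀ ν z : ℝ, 0 ≤ ν → ν ≤ 2 → 1 ≤ z → besselJ ν z ^ 2 ≤ C / z := by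
  obtain ⟨K, hK0, hK⟩ := exists_sq_besselJ_le
  set M := K * (5 / 2) ^ (6 : ℝ) * Real.exp 25
  have hM0 : 0 < M := by positivity
  have hM (ν z : ℝ) (hν : 0 ≤ ν) (hν3 : ν ≤ 3) (hz : 0 ≤ z) (hz5 : z ≤ 5) :
      besselJ ν z ^ 2 ≤ M := by
    refine (hK ν z hν hz).trans ?_
    have h1 : (z / 2) ^ (2 * ν) ≤ (5 / 2) ^ (6 : ℝ) :=
      (Real.rpow_le_rpow (by positivity) (by linarith) (by positivity)).trans
        (Real.rpow_le_rpow_of_exponent_le (by norm_num) (by linarith))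
    have h2 : Real.exp (z ^ 2) ≤ Real.exp 25 := Real.exp_le_exp.2 (by nlinarith)
    change _ ≤ K * (5 / 2) ^ (6 : ℝ) * Real.exp 25
    gcongr
  have he : 1 ≤ Real.exp 1 := Real.one_le_exp zero_le_one
  refine ⟨30 * M * Real.exp 1, by positivity, fun ν z hν hν2 hz => ?_⟩
  have hz0 : 0 < z := by linarith
  rw [le_div_iff₀ hz0]
  rcases le_total z 5 with h5 | h5
  · have := hM ν z hν (by linarith) hz0.le h5
    nlinarith [mul_le_mul this h5 hz0.le hM0.le]
  · have h1 : besselEnergy ν z * Real.exp (5 / z) ≤ besselEnergy ν 5 * Real.exp (5 / 5) :=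
      antitoneOn_besselEnergy_mul_exp hν hν2 Set.self_mem_Ici (Set.mem_Ici.2 h5) h5
    have h2 := half_mul_le_besselEnergy hν (by linarith : 2 * ν + 1 ≤ z)
    have h3 := hM ν 5 hν (by linarith) (by norm_num) le_rfl
    have h4 := hM (ν + 1) 5 (by linarith) (by linarith) (by norm_num) le_rfl
    have h5' : besselEnergy ν 5 ≤ 15 * M := by
      rw [besselEnergy]
      nlinarith [sq_nonneg (besselJ ν 5 + besselJ (ν + 1) 5), sq_nonneg (besselJ ν 5),
        mul_nonneg hν (sq_nonneg (besselJ ν 5 + besselJ (ν + 1) 5)),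
        mul_nonneg hν (sub_nonneg.2 h3), mul_nonneg hν (sub_nonneg.2 h4),
        mul_nonneg (sub_nonneg.2 hν2) hM0.le]
    have h6 : 0 ≤ besselEnergy ν z := le_trans (by positivity) h2
    have h7 : 1 ≤ Real.exp (5 / z) := Real.one_le_exp (by positivity)
    rw [div_self (by norm_num : (5 : ℝ) ≠ 0)] at h1
    have h8 := le_mul_of_one_le_right h6 h7
    have h9 := mul_le_mul_of_nonneg_right h5' (by positivity : 0 ≤ Real.exp 1)
    have h10 : 0 ≤ z / 2 * besselJ (ν + 1) z ^ 2 := by positivity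
    linarith

lemma intervalIntegrable_sq_besselJ_mul {ν b : ℝ} (hν : 0 ≤ ν) (hb : 1 ≤ b) {f : ℝ → ℝ}
    (hf : ContinuousOn f (Set.Ioi 0)) :
    IntervalIntegrable (fun t => besselJ ν t ^ 2 * f t) MeasureTheory.volume 1 b := by
  refine ContinuousOn.intervalIntegrable (ContinuousOn.mono
    (((continuousOn_besselJ hν).pow 2).mul hf) ?_)
  rw [Set.uIcc_of_le hb]
  exact fun t ht => lt_of_lt_of_le one_pos ht.1

lemma intervalIntegrable_sq_besselJ_div {ν b : ℝ} (hν : 0 ≤ ν) (hb : 1 ≤ b) :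
    IntervalIntegrable (fun t => besselJ ν t ^ 2 / t) MeasureTheory.volume 1 b :=
  intervalIntegrable_sq_besselJ_mul hν hb
    (continuousOn_id.inv₀ fun _ ht => (Set.mem_Ioi.1 ht).ne')

lemma intervalIntegrable_sq_besselJ_div_sq {ν b : ℝ} (hν : 0 ≤ ν) (hb : 1 ≤ b) :
    IntervalIntegrable (fun t => besselJ ν t ^ 2 / t ^ 2) MeasureTheory.volume 1 b :=
  intervalIntegrable_sq_besselJ_mul hν hb
    ((continuousOn_id.pow 2).inv₀ fun _ ht => (pow_pos (Set.mem_Ioi.1 ht) 2).ne')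

lemma integral_inv_sq_le {b : ℝ} (hb : 1 ≤ b) : ∫ t in (1 : ℝ)..b, (t ^ 2)⁻¹ ≤ 1 := by
  have hpos {t : ℝ} (ht : t ∈ Set.uIcc 1 b) : 0 < t := by
    rw [Set.uIcc_of_le hb] at ht
    linarith [ht.1]
  rw [intervalIntegral.integral_eq_sub_of_hasDerivAt (f := fun t => -t⁻¹)
    (f' := fun t => (t ^ 2)⁻¹)
    (fun t ht => (hasDerivAt_inv (hpos ht).ne').neg.congr_deriv (neg_neg _))
    (ContinuousOn.intervalIntegrable
      ((continuousOn_id.pow 2).inv₀ fun t ht => (pow_pos (hpos ht) 2).ne'))]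
  have : 0 ≤ b⁻¹ := by positivity
  norm_num
  linarith

lemma integral_sq_besselJ_div_telescope {ν b : ℝ} (hν : 0 ≤ ν) (hb : 1 ≤ b) :
    2 * ν * (∫ t in (1 : ℝ)..b, besselJ ν t ^ 2 / t)
        - 2 * (ν + 1) * (∫ t in (1 : ℝ)..b, besselJ (ν + 1) t ^ 2 / t)
      = (besselJ ν b ^ 2 + besselJ (ν + 1) b ^ 2)
        - (besselJ ν 1 ^ 2 + besselJ (ν + 1) 1 ^ 2) := by
  have i0 := (intervalIntegrable_sq_besselJ_div hν hb).const_mul (2 * ν)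
  have i1 := (intervalIntegrable_sq_besselJ_div (by linarith : 0 ≤ ν + 1) hb).const_mul
    (2 * (ν + 1))
  rw [← intervalIntegral.integral_const_mul, ← intervalIntegral.integral_const_mul,
    ← intervalIntegral.integral_sub i0 i1]
  refine intervalIntegral.integral_eq_sub_of_hasDerivAt
    (f := fun t => besselJ ν t ^ 2 + besselJ (ν + 1) t ^ 2) (fun t ht => ?_) (i0.sub i1)
  rw [Set.uIcc_of_le hb] at ht
  have ht0 : 0 < t := by linarith [ht.1]
  refine (((hasDerivAt_besselJ hν ht0).pow 2).add
    ((hasDerivAt_besselJ_succ hν ht0).pow 2)).congr_deriv ?_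
  field_simp
  ring

lemma exists_integral_sq_besselJ_div_le :
    ∃ K : ℝ, 0 < K ∧ ∀ ν b : ℝ, 1 ≤ ν → 1 ≤ b →
      ∫ t in (1 : ℝ)..b, besselJ ν t ^ 2 / t ≤ K / ν := by
  obtain ⟨C, hC0, hC⟩ := exists_sq_besselJ_le_div
  obtain ⟨D, hD0, hD⟩ := exists_sq_besselJ_le
  set E := D * Real.exp 1
  have hE0 : 0 < E := by positivity
  have hE (μ : ℝ) (hμ : 1 ≤ μ) (n : ℕ) : besselJ (μ + n) 1 ^ 2 ≤ E * (1 / 4) ^ n := by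
    refine (hD (μ + n) 1 (by positivity) zero_le_one).trans ?_
    have : (1 / 2 : ℝ) ^ (2 * (μ + n)) ≤ (1 / 4) ^ n := by
      calc (1 / 2 : ℝ) ^ (2 * (μ + n)) ≤ (1 / 2 : ℝ) ^ (((2 * n : ℕ) : ℝ)) :=
            Real.rpow_le_rpow_of_exponent_ge (by norm_num) (by norm_num)
              (by push_cast; linarith)
        _ = _ := by rw [Real.rpow_natCast, pow_mul]; norm_num
    rw [one_pow]
    calc _ ≤ D * (1 / 4) ^ n * Real.exp 1 := by gcongr
      _ = _ := by ring
  have main (μ b : ℝ) (hμ : 1 ≤ μ) (hμ2 : μ ≤ 2) (hb : 1 ≤ b) (n : ℕ) :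
      2 * (μ + n) * (∫ t in (1 : ℝ)..b, besselJ (μ + n) t ^ 2 / t)
        ≤ 4 * C + 4 * E - 4 * E * (1 / 4) ^ n := by
    induction n with
    | zero =>
      have h : ∫ t in (1 : ℝ)..b, besselJ μ t ^ 2 / t ≤ ∫ t in (1 : ℝ)..b, C * (t ^ 2)⁻¹ := by
        refine intervalIntegral.integral_mono_on hb
          (intervalIntegrable_sq_besselJ_div (by linarith) hb) ?_ fun t ht => ?_
        · refine ContinuousOn.intervalIntegrable (continuousOn_const.mul
            ((continuousOn_id.pow 2).inv₀ fun t ht => ?_))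
          rw [Set.uIcc_of_le hb] at ht
          have : 0 < t := by linarith [ht.1]
          exact (pow_pos this 2).ne'
        · have ht0 : 0 < t := by linarith [ht.1]
          calc besselJ μ t ^ 2 / t ≤ C / t / t := by
                gcongr
                exact hC μ t (by linarith) hμ2 ht.1
            _ = _ := by field_simp
      rw [intervalIntegral.integral_const_mul] at h
      have h1 : ∫ t in (1 : ℝ)..b, besselJ μ t ^ 2 / t ≤ C := by
        nlinarith [integral_inv_sq_le hb]
      simp only [Nat.cast_zero, add_zero, pow_zero]
      nlinarith [mul_le_mul_of_nonneg_left h1 (by linarith : 0 ≤ 2 * μ)]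
    | succ n ih =>
      have h := integral_sq_besselJ_div_telescope (by positivity : 0 ≤ μ + n) hb
      have h1 := hE μ hμ n
      have h2 := hE μ hμ (n + 1)
      push_cast at h2 ⊢
      rw [← add_assoc] at h2 ⊢
      have h3 : 0 < E * (1 / 4) ^ n := by positivity
      rw [pow_succ (1 / 4 : ℝ)] at h2 ⊢
      nlinarith [sq_nonneg (besselJ (μ + n) b), sq_nonneg (besselJ (μ + n + 1) b)]
  refine ⟨2 * C + 2 * E, by positivity, fun ν b hν hb => ?_⟩
  have hfl : (⌊ν - 1⌋₊ : ℝ) ≤ ν - 1 := Nat.floor_le (by linarith)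
  have hfl2 : ν - 1 < ⌊ν - 1⌋₊ + 1 := Nat.lt_floor_add_one _
  have h := main (ν - ⌊ν - 1⌋₊) b (by linarith) (by linarith) hb ⌊ν - 1⌋₊
  rw [sub_add_cancel] at h
  have : 0 < 4 * E * (1 / 4) ^ ⌊ν - 1⌋₊ := by positivity
  rw [le_div_iff₀ (by linarith)]
  linarith

lemma exists_integral_sq_besselJ_div_sq_le :
    ∃ K : ℝ, 0 < K ∧ ∀ ν b : ℝ, 0 ≤ ν → 1 ≤ b →
      ∫ t in (1 : ℝ)..b, besselJ ν t ^ 2 / t ^ 2 ≤ K / (1 + ν ^ 2) := by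
  obtain ⟨C, hC0, hC⟩ := exists_sq_besselJ_le_div
  obtain ⟨K, hK0, hK⟩ := exists_integral_sq_besselJ_div_le
  refine ⟨5 * C + 4 * K, by positivity, fun ν b hν hb => ?_⟩
  have hI := intervalIntegrable_sq_besselJ_div_sq hν hb
  rw [le_div_iff₀ (by positivity)]
  rcases le_total ν 2 with h2 | h2
  · have h : ∫ t in (1 : ℝ)..b, besselJ ν t ^ 2 / t ^ 2 ≤ ∫ t in (1 : ℝ)..b, C * (t ^ 2)⁻¹ := by
      refine intervalIntegral.integral_mono_on hb hI ?_ fun t ht => ?_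
      · refine ContinuousOn.intervalIntegrable (continuousOn_const.mul
          ((continuousOn_id.pow 2).inv₀ fun t ht => ?_))
        rw [Set.uIcc_of_le hb] at ht
        have : 0 < t := by linarith [ht.1]
        exact (pow_pos this 2).ne'
      · have ht0 : 0 < t := by linarith [ht.1]
        rw [← div_eq_mul_inv]
        gcongr
        exact (hC ν t hν h2 ht.1).trans (div_le_self hC0.le ht.1)
    rw [intervalIntegral.integral_const_mul] at h
    have h1 : ∫ t in (1 : ℝ)..b, besselJ ν t ^ 2 / t ^ 2 ≤ C := by
      nlinarith [integral_inv_sq_le hb]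
    calc _ ≤ C * (1 + ν ^ 2) := by gcongr
      _ ≤ C * 5 := by
          gcongr
          nlinarith
      _ ≤ _ := by linarith
  · have hν0 : 0 < ν := by linarith
    have i0 := (intervalIntegrable_sq_besselJ_div (by linarith : 0 ≤ ν - 1) hb).const_mul
      (1 / (4 * ν))
    have i1 := (intervalIntegrable_sq_besselJ_div (by linarith : 0 ≤ ν + 1) hb).const_mul
      (1 / (4 * ν))
    have i2 := (intervalIntegrable_sq_besselJ_div hν hb).const_mul (1 / (2 * ν))
    have h := intervalIntegral.integral_mono_on hb hI ((i0.add i1).add i2) fun t ht => by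
      have ht0 : 0 < t := by linarith [ht.1]
      have hr := besselJ_recurrence (by linarith : 0 ≤ ν - 1) ht0
      rw [show ν - 1 + 2 = ν + 1 by ring, sub_add_cancel] at hr
      set A := besselJ (ν - 1) t
      set B := besselJ (ν + 1) t
      have hJ : besselJ ν t = t / (2 * ν) * (A + B) := by
        rw [hr]
        field_simp
      have h3 : besselJ ν t ^ 2 ≤ t ^ 2 / (2 * ν ^ 2) * (A ^ 2 + B ^ 2) := by
        calc besselJ ν t ^ 2 = t ^ 2 / (2 * ν ^ 2) * ((A + B) ^ 2 / 2) := by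
              rw [hJ]
              field_simp
          _ ≤ _ := by
              gcongr
              linarith [sq_nonneg (A - B)]
      calc besselJ ν t ^ 2 / t ^ 2
          ≤ besselJ ν t ^ 2 * (ν / (2 * t ^ 3) + 1 / (2 * ν * t)) := by
            rw [div_eq_mul_one_div]
            gcongr
            rw [← sub_nonneg]
            have : ν / (2 * t ^ 3) + 1 / (2 * ν * t) - 1 / t ^ 2
                = (ν - t) ^ 2 / (2 * ν * t ^ 3) := by
              field_simp
              ring
            rw [this]
            positivity
        _ = besselJ ν t ^ 2 * (ν / (2 * t ^ 3)) + 1 / (2 * ν) * (besselJ ν t ^ 2 / t) := by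
            field_simp
        _ ≤ t ^ 2 / (2 * ν ^ 2) * (A ^ 2 + B ^ 2) * (ν / (2 * t ^ 3))
              + 1 / (2 * ν) * (besselJ ν t ^ 2 / t) := by gcongr
        _ = 1 / (4 * ν) * (A ^ 2 / t) + 1 / (4 * ν) * (B ^ 2 / t)
              + 1 / (2 * ν) * (besselJ ν t ^ 2 / t) := by
            field_simp
            ring
    rw [intervalIntegral.integral_add (i0.add i1) i2, intervalIntegral.integral_add i0 i1,
      intervalIntegral.integral_const_mul, intervalIntegral.integral_const_mul,
      intervalIntegral.integral_const_mul] at h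
    have h4 : ∫ t in (1 : ℝ)..b, besselJ (ν - 1) t ^ 2 / t ≤ 2 * K / ν := by
      refine (hK (ν - 1) b (by linarith) hb).trans ?_
      rw [div_le_div_iff₀ (by linarith) hν0]
      nlinarith
    have h5 : ∫ t in (1 : ℝ)..b, besselJ (ν + 1) t ^ 2 / t ≤ K / ν :=
      (hK (ν + 1) b (by linarith) hb).trans (by gcongr; linarith)
    have h6 := hK ν b (by linarith) hb
    have h7 : ∫ t in (1 : ℝ)..b, besselJ ν t ^ 2 / t ^ 2 ≤ 2 * K / ν ^ 2 := by
      refine h.trans ?_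
      calc _ ≤ 1 / (4 * ν) * (2 * K / ν) + 1 / (4 * ν) * (K / ν) + 1 / (2 * ν) * (K / ν) := by
            gcongr
        _ = (5 / 4) * K / ν ^ 2 := by
            field_simp
            ring
        _ ≤ _ := by
            gcongr
            norm_num
    calc _ ≤ 2 * K / ν ^ 2 * (1 + ν ^ 2) := by gcongr
      _ = 2 * K + 2 * K / ν ^ 2 := by field_simp; ring
      _ ≤ 2 * K + 2 * K := by
          gcongr
          exact div_le_self (by positivity) (by nlinarith)
      _ ≤ _ := by linarith

lemma exists_integral_Ioi_sq_besselJ_div_sq_le :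
    ∃ K : ℝ, 0 < K ∧ ∀ ν : ℝ, 0 ≤ ν →
      MeasureTheory.IntegrableOn (fun t => besselJ ν t ^ 2 / t ^ 2) (Set.Ioi 1) ∧
      ∫ t in Set.Ioi (1 : ℝ), besselJ ν t ^ 2 / t ^ 2 ≤ K / (1 + ν ^ 2) := by
  obtain ⟨K, hK0, hK⟩ := exists_integral_sq_besselJ_div_sq_le
  refine ⟨K, hK0, fun ν hν => ?_⟩
  have hb : Filter.Tendsto (fun n : ℕ => (n : ℝ) + 1) Filter.atTop Filter.atTop :=
    Filter.tendsto_atTop_add_const_right _ _ tendsto_natCast_atTop_atTop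
  have hb1 (n : ℕ) : (1 : ℝ) ≤ n + 1 := by simp
  have hint : MeasureTheory.IntegrableOn (fun t => besselJ ν t ^ 2 / t ^ 2) (Set.Ioi 1) := by
    refine MeasureTheory.integrableOn_Ioi_of_intervalIntegral_norm_bounded (K / (1 + ν ^ 2)) 1
      (fun n : ℕ => (intervalIntegrable_sq_besselJ_div_sq hν (hb1 n)).1) hb
      (Filter.Eventually.of_forall fun n => ?_)
    simp only [Real.norm_of_nonneg (div_nonneg (sq_nonneg (besselJ ν _)) (sq_nonneg _))]
    exact hK ν _ hν (hb1 n)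
  exact ⟨hint, le_of_tendsto' (MeasureTheory.intervalIntegral_tendsto_integral_Ioi 1 hint hb)
    fun n => hK ν _ hν (hb1 n)⟩

lemma half_rpow_two_mul_le {ν : ℝ} (hν : 0 ≤ ν) : (1 / 2 : ℝ) ^ (2 * ν) ≤ 2 / (1 + ν ^ 2) := by
  have h1 : 1 + ν ^ 2 ≤ 2 * Real.exp ν := by
    linarith [Real.quadratic_le_exp_of_nonneg hν]
  have h2 : Real.exp ν ≤ 4 ^ ν := by
    rw [← Real.exp_one_rpow]
    exact Real.rpow_le_rpow (Real.exp_pos 1).le (by linarith [Real.exp_one_lt_d9]) hν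
  have h3 : (1 / 2 : ℝ) ^ (2 * ν) = (4 ^ ν)⁻¹ := by
    rw [Real.rpow_mul (by norm_num), ← Real.inv_rpow (by norm_num)]
    norm_num
  have h4 : (0 : ℝ) < 4 ^ ν := by positivity
  rw [h3, inv_eq_one_div, div_le_div_iff₀ h4 (by positivity)]
  linarith

lemma sqrt_mul_rpow_two_mul_le {lam r ν p : ℝ} (hl : 0 < lam) (hr : 1 ≤ r)
    (h : Real.sqrt lam * r ≤ 1) :
    (Real.sqrt lam * r) ^ (2 * ν) ≤ (lam ^ ν + lam ^ p) * r ^ (2 * p) := by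
  have hr0 : 0 < r := by linarith
  have hq0 : 0 < Real.sqrt lam := Real.sqrt_pos.2 hl
  have hsplit (a : ℝ) : (Real.sqrt lam * r) ^ (2 * a) = lam ^ a * r ^ (2 * a) := by
    rw [Real.mul_rpow hq0.le hr0.le, Real.rpow_mul hq0.le, Real.rpow_two, Real.sq_sqrt hl.le]
  have h1 : 0 < lam ^ ν := by positivity
  have h2 : 0 < lam ^ p := by positivity
  rcases le_total ν p with hp | hp
  · rw [hsplit]
    have := Real.rpow_le_rpow_of_exponent_le hr (by linarith : 2 * ν ≤ 2 * p)
    gcongr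
    linarith
  · calc _ ≤ (Real.sqrt lam * r) ^ (2 * p) :=
          Real.rpow_le_rpow_of_exponent_ge (by positivity) h (by linarith)
      _ = lam ^ p * r ^ (2 * p) := hsplit p
      _ ≤ _ := by
          gcongr
          linarith

theorem stmt8 (ε s : ℝ) (hε0 : 0 < ε) (hε1 : ε < 1) (hs : 3/2 + ε < s) :
    ∃ C : ℝ, 0 < C ∧ ∀ ν : ℝ, 0 ≤ ν → ∀ lam : ℝ, 0 < lam → lam < 1 →
      (∫ r in Set.Ioi (1:ℝ), (besselJ ν (Real.sqrt lam * r))^2 * (1+r) ^ (-(2*s)) * r) ≤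
        C * (lam ^ ν + lam ^ (1/2 + ε)) / (1 + ν^2) := by
  obtain ⟨K, hK0, hK⟩ := exists_sq_besselJ_le
  obtain ⟨M, hM0, hM⟩ := exists_integral_Ioi_sq_besselJ_div_sq_le
  set p := 1 / 2 + ε with hp
  set W := ∫ r in Set.Ioi (1 : ℝ), r ^ (2 * p + 1 - 2 * s)
  have hWint : MeasureTheory.IntegrableOn (fun r : ℝ => r ^ (2 * p + 1 - 2 * s)) (Set.Ioi 1) :=
    integrableOn_Ioi_rpow_of_lt (by linarith) one_pos
  have hW0 : 0 ≤ W := MeasureTheory.setIntegral_nonneg measurableSet_Ioi fun r hr =>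
    Real.rpow_nonneg (by linarith [Set.mem_Ioi.1 hr]) _
  refine ⟨2 * K * Real.exp 1 * W + M, by positivity, fun ν hν lam hl _ => ?_⟩
  obtain ⟨hint, hle⟩ := hM ν hν
  set q := Real.sqrt lam with hq
  have hq0 : 0 < q := Real.sqrt_pos.2 hl
  have hqp : q ^ (2 * p) = lam ^ p := by
    rw [Real.rpow_mul hq0.le, Real.rpow_two, Real.sq_sqrt hl.le]
  set g : ℝ → ℝ := (Set.Ioi 1).indicator fun t => besselJ ν t ^ 2 / t ^ 2
  have hg0 (t : ℝ) : 0 ≤ g t := Set.indicator_nonneg (fun t _ => by positivity) t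
  have hgint : MeasureTheory.Integrable g :=
    (MeasureTheory.integrable_indicator_iff measurableSet_Ioi).2 hint
  have hgle : ∫ t, g t ≤ M / (1 + ν ^ 2) := by
    rwa [MeasureTheory.integral_indicator measurableSet_Ioi]
  have hgq := hgint.comp_mul_left' hq0.ne'
  have hgqle : ∫ r in Set.Ioi (1 : ℝ), g (q * r) ≤ q⁻¹ * (M / (1 + ν ^ 2)) := by
    refine (MeasureTheory.setIntegral_le_integral hgq
      (Filter.Eventually.of_forall fun r => hg0 _)).trans ?_
    rw [MeasureTheory.Measure.integral_comp_mul_left, abs_of_pos (inv_pos.2 hq0), smul_eq_mul]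
    gcongr
  set c := 2 * K * Real.exp 1 * (lam ^ ν + lam ^ p) / (1 + ν ^ 2)
  have hc0 : 0 ≤ c := by positivity
  have i1 := hWint.const_mul c
  have i2 := (hgq.integrableOn (s := Set.Ioi 1)).const_mul (q ^ (2 * p + 1))
  have hbound : ∀ r ∈ Set.Ioi (1 : ℝ), besselJ ν (q * r) ^ 2 * (1 + r) ^ (-(2 * s)) * r
      ≤ c * r ^ (2 * p + 1 - 2 * s) + q ^ (2 * p + 1) * g (q * r) := by
    intro r hr
    have hr1 : 1 < r := hr
    have hr0 : 0 < r := by linarith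
    have h1 : (1 + r) ^ (-(2 * s)) * r ≤ r ^ (1 - 2 * s) := by
      rw [show 1 - 2 * s = -(2 * s) + 1 by ring, Real.rpow_add_one hr0.ne']
      gcongr ?_ * r
      exact Real.rpow_le_rpow_of_nonpos hr0 (by linarith) (by linarith)
    rw [mul_assoc]
    rcases le_or_gt (q * r) 1 with h | h
    · have h2 : besselJ ν (q * r) ^ 2 ≤ c * r ^ (2 * p) := by
        refine (hK ν (q * r) hν (by positivity)).trans ?_
        have h3 : Real.exp ((q * r) ^ 2) ≤ Real.exp 1 :=
          Real.exp_le_exp.2 (pow_le_one₀ (by positivity) h)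
        rw [show q * r / 2 = q * r * (1 / 2) by ring,
          Real.mul_rpow (by positivity) (by norm_num)]
        calc _ ≤ K * (((lam ^ ν + lam ^ p) * r ^ (2 * p)) * (2 / (1 + ν ^ 2))) * Real.exp 1 := by
              gcongr
              · exact sqrt_mul_rpow_two_mul_le hl hr1.le h
              · exact half_rpow_two_mul_le hν
          _ = _ := by ring
      calc _ ≤ c * r ^ (2 * p) * r ^ (1 - 2 * s) := by gcongr
        _ = c * r ^ (2 * p + 1 - 2 * s) := by
            rw [mul_assoc, ← Real.rpow_add hr0]
            ring_nf
        _ ≤ _ := le_add_of_nonneg_right (mul_nonneg (by positivity) (hg0 _))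
    · have hg : g (q * r) = besselJ ν (q * r) ^ 2 / (q * r) ^ 2 := Set.indicator_of_mem h _
      have h2 : r ^ (1 - 2 * s) ≤ q ^ (2 * p + 1) * ((q * r) ^ 2)⁻¹ := by
        calc r ^ (1 - 2 * s) ≤ r ^ (-(2 * p + 1)) :=
              Real.rpow_le_rpow_of_exponent_le hr1.le (by linarith)
          _ = q ^ (2 * p + 1) * (q * r) ^ (-(2 * p + 1)) := by
              rw [Real.mul_rpow hq0.le hr0.le, ← mul_assoc, ← Real.rpow_add hq0,
                add_neg_cancel, Real.rpow_zero, one_mul]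
          _ ≤ q ^ (2 * p + 1) * (q * r) ^ (-2 : ℝ) := by
              gcongr ?_ * ?_
              exact Real.rpow_le_rpow_of_exponent_le h.le (by linarith)
          _ = _ := by rw [Real.rpow_neg (by positivity), Real.rpow_two]
      calc _ ≤ besselJ ν (q * r) ^ 2 * (q ^ (2 * p + 1) * ((q * r) ^ 2)⁻¹) :=
            mul_le_mul_of_nonneg_left (h1.trans h2) (sq_nonneg _)
        _ = q ^ (2 * p + 1) * g (q * r) := by
            rw [hg]
            ring
        _ ≤ _ := le_add_of_nonneg_left (by positivity)
  calc _ ≤ ∫ r in Set.Ioi (1 : ℝ),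
        (c * r ^ (2 * p + 1 - 2 * s) + q ^ (2 * p + 1) * g (q * r)) := by
        refine MeasureTheory.integral_mono_of_nonneg ?_ (i1.add i2) ?_
        · filter_upwards [MeasureTheory.ae_restrict_mem measurableSet_Ioi] with r hr
          have : 0 < r := by linarith [Set.mem_Ioi.1 hr]
          simp only [Pi.zero_apply]
          positivity
        · filter_upwards [MeasureTheory.ae_restrict_mem measurableSet_Ioi] with r hr
          exact hbound r hr
    _ = c * W + q ^ (2 * p + 1) * ∫ r in Set.Ioi (1 : ℝ), g (q * r) := by
        rw [MeasureTheory.integral_add i1 i2, MeasureTheory.integral_const_mul,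
          MeasureTheory.integral_const_mul]
    _ ≤ c * W + q ^ (2 * p + 1) * (q⁻¹ * (M / (1 + ν ^ 2))) := by gcongr
    _ = c * W + lam ^ p * (M / (1 + ν ^ 2)) := by
        rw [Real.rpow_add_one hq0.ne', hqp]
        field_simp
    _ ≤ c * W + (lam ^ ν + lam ^ p) * (M / (1 + ν ^ 2)) := by
        gcongr
        exact le_add_of_nonneg_left (by positivity)
    _ = _ := by ring
end
end
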